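/- Assume the standing hypotheses on system (S) and suppose there exists ω ∈ ℝ² with L(ω) = 0 such that the Jacobian matrix JL(ω) is a D⁻-matrix. Then there exists a Lebesgue-measurable set E ⊆ ℝ⁴ of infinite Lebesgue measure such that every C² solution x = (x₁,x₂) : (−∞,0] → ℝ² of (S) with (x₁(0), x₂(0), ẋ₁(0), ẋ₂(0)) ∈ E satisfies lim_{t→−∞} (x_i(t)² + ẋ_i(t)²) = +∞ for i = 1,2. -/

import Mathlib

open Real MeasureTheory Filter

noncomputable section

/-- `C` is the asymmetric cosine of the pair `(a, b)` for the resonance integer `n`: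
the even, `2π/n`-periodic function equal to `cos(√a t)` on `[0, π/(2√a)]` and to
`−√(a/b)·sin(√b(t − π/(2√a)))` on `[π/(2√a), π/n]`. -/
def IsAsymCos (n : ℕ) (a b : ℝ) (C : ℝ → ℝ) : Prop :=
  (∀ t, C (-t) = C t) ∧ (∀ t, C (t + 2 * π / n) = C t) ∧
  (∀ t ∈ Set.Icc (0 : ℝ) (π / (2 * Real.sqrt a)), C t = Real.cos (Real.sqrt a * t)) ∧
  (∀ t ∈ Set.Icc (π / (2 * Real.sqrt a)) (π / n),
      C t = - Real.sqrt (a / b) * Real.sin (Real.sqrt b * (t - π / (2 * Real.sqrt a))))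


/-- the asymmetric restoring force -/
def gg (a b x : ℝ) : ℝ := a * max x 0 - b * max (-x) 0

/-- The energy. -/
def HH (a b x v : ℝ) : ℝ := v ^ 2 + a * (max x 0) ^ 2 + b * (max (-x) 0) ^ 2

/-- Properties of the asymmetric cosine `C` and its derivative `S`. -/
structure ACos (n : ℕ) (a b h : ℝ) (C S : ℝ → ℝ) : Prop where
  hn : 0 < (n : ℝ)
  ha : 0 < a
  hb : 0 < b
  hh : 0 < h
  hhT : 2 * h < 2 * π / n
  dC : ∀ t, HasDerivAt C (S t) t
  dS : ∀ t, HasDerivAt S (-gg a b (C t)) t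
  pC : ∀ t, C (t + 2 * π / n) = C t
  pS : ∀ t, S (t + 2 * π / n) = S t
  en : ∀ t, HH a b (C t) (S t) = a
  pos : ∀ t ∈ Set.Ioo (-h) h, 0 < C t
  neg : ∀ t ∈ Set.Ioo h (2 * π / n - h), C t < 0
  Sh : S h = - √a
  Sh' : S (-h) = √a

lemma glue {T h : ℝ} (hh : 0 < h) (hT : 2 * h < T) {F G f1 f2 g1 g2 : ℝ → ℝ}
    (pF : ∀ t, F (t + T) = F t) (pG : ∀ t, G (t + T) = G t)
    (F1 : ∀ t ∈ Set.Icc (-h) h, F t = f1 t) (F2 : ∀ t ∈ Set.Icc h (T - h), F t = f2 t)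
    (G1 : ∀ t ∈ Set.Icc (-h) h, G t = g1 t) (G2 : ∀ t ∈ Set.Icc h (T - h), G t = g2 t)
    (d1 : ∀ t ∈ Set.Icc (-h) h, HasDerivAt f1 (g1 t) t)
    (d2 : ∀ t ∈ Set.Icc h (T - h), HasDerivAt f2 (g2 t) t) (t : ℝ) :
    HasDerivAt F (G t) t := by
  have hT0 : 0 < T := by linarith
  -- main claim on a fundamental domain
  have key : ∀ r ∈ Set.Ico (-h) (T - h), HasDerivAt F (G r) r := by
    intro r hr
    have junction : ∀ (A B : ℝ → ℝ) (D l m u : ℝ), l < m → m < u → (∀ s ∈ Set.Icc l m, F s = A s) →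
        (∀ s ∈ Set.Icc m u, F s = B s) → HasDerivAt A D m → HasDerivAt B D m →
        HasDerivAt F D m := by
      intro A B D l m u hl hu hA hB dA dB
      have e1 : HasDerivWithinAt F D (Set.Icc l m) m :=
        dA.hasDerivWithinAt.congr hA (hA m ⟨hl.le, le_rfl⟩)
      have e2 : HasDerivWithinAt F D (Set.Icc m u) m :=
        dB.hasDerivWithinAt.congr hB (hB m ⟨le_rfl, hu.le⟩)
      have e3 := e1.union e2
      rw [Set.Icc_union_Icc_eq_Icc hl.le hu.le] at e3
      exact e3.hasDerivAt (Icc_mem_nhds hl hu)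
    rcases eq_or_lt_of_le hr.1 with h1 | h1
    · -- r = -h
      subst h1
      have e2 : G (-h) = g2 (T - h) := by
        rw [← pG (-h), ← G2 (T - h) ⟨by linarith, le_rfl⟩]; congr 1; ring
      refine junction (fun s => f2 (s + T)) f1 _ (h - T) (-h) h (by linarith) (by linarith) ?_ F1 ?_ ?_
      · intro s hs
        rw [← pF s]; exact F2 _ ⟨by linarith [hs.1], by linarith [hs.2]⟩
      · rw [e2]
        have := d2 (T - h) ⟨by linarith, le_rfl⟩
        have e : T - h = -h + T := by ring
        rw [e] at this ⊢
        exact HasDerivAt.comp_add_const (-h) T this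
      · rw [G1 (-h) ⟨le_rfl, by linarith⟩]; exact d1 _ ⟨le_rfl, by linarith⟩
    rcases lt_trichotomy r h with h2 | h2 | h2
    · refine junction f1 f1 _ (-h) r h h1 h2 (fun s hs => F1 s ⟨hs.1, by linarith [hs.2]⟩)
        (fun s hs => F1 s ⟨by linarith [hs.1], hs.2⟩) ?_ ?_ <;>
      · rw [G1 r ⟨h1.le, h2.le⟩]; exact d1 _ ⟨h1.le, h2.le⟩
    · subst h2
      refine junction f1 f2 _ (-r) r (T - r) h1 (by linarith) F1 F2 ?_ ?_
      · rw [G1 r ⟨h1.le, le_rfl⟩]; exact d1 _ ⟨h1.le, le_rfl⟩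
      · rw [G2 r ⟨le_rfl, by linarith⟩]; exact d2 _ ⟨le_rfl, by linarith⟩
    · refine junction f2 f2 _ h r (T - h) h2 hr.2 (fun s hs => F2 s ⟨hs.1, by linarith [hs.2, hr.2]⟩)
        (fun s hs => F2 s ⟨by linarith [hs.1], hs.2⟩) ?_ ?_ <;>
      · rw [G2 r ⟨h2.le, hr.2.le⟩]; exact d2 _ ⟨h2.le, hr.2.le⟩
  have hr := toIcoMod_mem_Ico hT0 (-h) t
  have hr' : toIcoMod hT0 (-h) t ∈ Set.Ico (-h) (T - h) := ⟨hr.1, by linarith [hr.2]⟩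
  have k1 := key _ hr'
  have PF : Function.Periodic F T := pF
  have PG : Function.Periodic G T := pG
  rw [toIcoMod, PG.sub_zsmul_eq] at k1
  have k2 := HasDerivAt.comp_sub_const t (toIcoDiv hT0 (-h) t • T) k1
  have e : (fun x => F (x - toIcoDiv hT0 (-h) t • T)) = F := funext fun x => PF.sub_zsmul_eq _
  rw [e] at k2
  exact k2

lemma hasDerivAt_maxsq (x : ℝ) : HasDerivAt (fun x : ℝ => (max x 0) ^ 2) (2 * max x 0) x := by
  rcases lt_trichotomy x 0 with h | h | h
  · have : (fun x : ℝ => (max x 0) ^ 2) =ᶠ[nhds x] fun _ => 0 := by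
      filter_upwards [Iio_mem_nhds h] with y hy
      simp [max_eq_right (le_of_lt (Set.mem_Iio.1 hy))]
    rw [max_eq_right h.le, mul_zero]
    exact (hasDerivAt_const x (0:ℝ)).congr_of_eventuallyEq this
  · subst h
    have : HasDerivAt (fun x : ℝ => (max x 0) ^ 2) 0 0 := by
      rw [hasDerivAt_iff_isLittleO_nhds_zero]
      have : (fun h : ℝ => h ^ 2) =o[nhds 0] fun h => h := by
        simpa using (Asymptotics.isLittleO_pow_pow (𝕜 := ℝ) (show 1 < 2 by norm_num))
      refine Asymptotics.IsBigO.trans_isLittleO ?_ this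
      refine Asymptotics.IsBigO.of_bound 1 (Eventually.of_forall fun y => ?_)
      simp only [zero_add, max_self, smul_zero, sub_zero]
      rcases le_total y 0 with h | h <;> simp [h]
      positivity
    simpa using this
  · have : (fun x : ℝ => (max x 0) ^ 2) =ᶠ[nhds x] fun y => y ^ 2 := by
      filter_upwards [Ioi_mem_nhds h] with y hy
      simp [max_eq_left (le_of_lt (Set.mem_Ioi.1 hy))]
    rw [max_eq_left h.le]
    simpa using (hasDerivAt_pow 2 x).congr_of_eventuallyEq this

lemma hasDerivAt_HH (a b : ℝ) {x v : ℝ → ℝ} {x' v' t : ℝ} (hx : HasDerivAt x x' t)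
    (hv : HasDerivAt v v' t) :
    HasDerivAt (fun t => HH a b (x t) (v t)) (2 * v t * v' + 2 * gg a b (x t) * x') t := by
  have h1 := (hasDerivAt_maxsq (x t)).comp t hx
  have h2 := (hasDerivAt_maxsq (-x t)).comp t hx.neg
  have h3 := ((hv.pow 2).add (h1.const_mul a)).add (h2.const_mul b)
  refine HasDerivAt.congr_deriv (h3.congr_of_eventuallyEq (Eventually.of_forall fun y => ?_)) ?_
  · simp [HH, Function.comp]
  · simp [gg]; ring

lemma exists_periodic_glue {T h : ℝ} (hh : 0 < h) (hT : 2 * h < T) {s1 s2 : ℝ → ℝ}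
    (e1 : s1 h = s2 h) (e2 : s1 (-h) = s2 (T - h)) :
    ∃ S : ℝ → ℝ, (∀ t, S (t + T) = S t) ∧ (∀ t ∈ Set.Icc (-h) h, S t = s1 t) ∧
      (∀ t ∈ Set.Icc h (T - h), S t = s2 t) := by
  have hT0 : 0 < T := by linarith
  refine ⟨fun t => if toIcoMod hT0 (-h) t ≤ h then s1 (toIcoMod hT0 (-h) t)
    else s2 (toIcoMod hT0 (-h) t), ?_, ?_, ?_⟩
  · intro t
    simp
  · intro t ht
    have : toIcoMod hT0 (-h) t = t := by
      rw [toIcoMod_eq_self]; exact ⟨ht.1, by linarith [ht.2]⟩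
    simp [this, ht.2]
  · intro t ht
    rcases eq_or_lt_of_le ht.2 with h1 | h1
    · have : toIcoMod hT0 (-h) t = -h := by
        have : t = -h + T := by linarith
        rw [this]; simp
      simp only [this]
      rw [if_pos (by linarith), e2, h1]
    · have : toIcoMod hT0 (-h) t = t := by
        rw [toIcoMod_eq_self]; exact ⟨by linarith [ht.1], by linarith⟩
      simp only [this]
      split_ifs with h3
      · have : t = h := le_antisymm h3 ht.1
        rw [this, e1]
      · rfl

lemma asymcos_props {n : ℕ} (hn : 1 ≤ n) {a b : ℝ} (ha : (n : ℝ) ^ 2 / 4 < a) (hb : 0 < b)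
    (hres : 1 / √a + 1 / √b = 2 / (n : ℝ)) {C : ℝ → ℝ} (hC : IsAsymCos n a b C) :
    ∃ S, ACos n a b (π / (2 * √a)) C S := by
  have hn0 : (0 : ℝ) < n := by exact_mod_cast hn
  have ha0 : 0 < a := lt_of_le_of_lt (by positivity) ha
  have hw : 0 < √a := Real.sqrt_pos.2 ha0
  have hu : 0 < √b := Real.sqrt_pos.2 hb
  have hπ := Real.pi_pos
  obtain ⟨hev, hper, hc1, hc2⟩ := hC
  set w := √a with hwdef
  set u := √b with hudef
  have hwa : w ^ 2 = a := Real.sq_sqrt ha0.le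
  have hub : u ^ 2 = b := Real.sq_sqrt hb.le
  set h := π / (2 * w) with hhdef
  set T := 2 * π / n with hTdef
  have hh : 0 < h := by positivity
  have hwh : w * h = π / 2 := by rw [hhdef]; field_simp
  have hT : T - 2 * h = π / u := by
    have : T = π * (2 / n) := by rw [hTdef]; ring
    rw [this, ← hres, hhdef]; field_simp; ring
  have huT : u * (T - 2 * h) = π := by rw [hT]; field_simp
  have hTh : 2 * h < T := by have : 0 < π / u := by positivity
                             linarith
  have hsq : √(a / b) * u = w := by
    rw [Real.sqrt_div ha0.le, ← hwdef, ← hudef]; field_simp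
  have hsqpos : 0 < √(a / b) := Real.sqrt_pos.2 (by positivity)
  have hTn : T / 2 = π / n := by rw [hTdef]; ring
  have C1 : ∀ t ∈ Set.Icc (-h) h, C t = Real.cos (w * t) := by
    intro t ht
    rcases le_total 0 t with h0 | h0
    · exact hc1 t ⟨h0, ht.2⟩
    · rw [← hev, hc1 (-t) ⟨by linarith, by linarith [ht.1]⟩]
      rw [mul_neg, Real.cos_neg]
  have C2 : ∀ t ∈ Set.Icc h (T - h), C t = - √(a / b) * Real.sin (u * (t - h)) := by
    intro t ht
    rcases le_total t (T / 2) with h0 | h0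
    · exact hc2 t ⟨ht.1, by rw [← hTn]; exact h0⟩
    · rw [← hev, ← hper, hc2 (-t + T) ⟨by linarith [ht.2], by rw [← hTn]; linarith⟩]
      have : u * (-t + T - h) = π - u * (t - h) := by rw [← huT]; ring
      rw [this, Real.sin_pi_sub]
  obtain ⟨S, pS, S1, S2⟩ := exists_periodic_glue (T := T) hh hTh
    (s1 := fun t => - (w * Real.sin (w * t))) (s2 := fun t => - (w * Real.cos (u * (t - h))))
    (by simp [hwh]) (by
      have : u * (T - h - h) = π := by rw [← huT]; ring
      simp [hwh, this])
  have pos : ∀ t ∈ Set.Ioo (-h) h, 0 < C t := by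
    intro t ht
    rw [C1 t ⟨ht.1.le, ht.2.le⟩]
    apply Real.cos_pos_of_mem_Ioo
    constructor <;> nlinarith [ht.1, ht.2]
  have neg : ∀ t ∈ Set.Ioo h (T - h), C t < 0 := by
    intro t ht
    rw [C2 t ⟨ht.1.le, ht.2.le⟩]
    have : 0 < Real.sin (u * (t - h)) := by
      apply Real.sin_pos_of_pos_of_lt_pi
      · have := ht.1; apply mul_pos hu; linarith
      · rw [← huT]; have := ht.2; apply mul_lt_mul_of_pos_left _ hu; linarith
    nlinarith
  have nn : ∀ t ∈ Set.Icc (-h) h, 0 ≤ C t := by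
    intro t ht
    rw [C1 t ht]
    apply Real.cos_nonneg_of_mem_Icc
    constructor <;> nlinarith [ht.1, ht.2]
  have np : ∀ t ∈ Set.Icc h (T - h), C t ≤ 0 := by
    intro t ht
    rw [C2 t ht]
    have : 0 ≤ Real.sin (u * (t - h)) := by
      apply Real.sin_nonneg_of_nonneg_of_le_pi
      · have := ht.1; apply mul_nonneg hu.le; linarith
      · rw [← huT]; have := ht.2; apply mul_le_mul_of_nonneg_left _ hu.le; linarith
    nlinarith
  have dC : ∀ t, HasDerivAt C (S t) t := by
    intro t
    refine glue hh hTh hper pS C1 C2 S1 S2 ?_ ?_ t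
    · intro t _
      have h1 : HasDerivAt (fun t => w * t) w t := by simpa using (hasDerivAt_id t).const_mul w
      exact h1.cos.congr_deriv (by ring)
    · intro t _
      have h1 : HasDerivAt (fun t => u * (t - h)) u t := by
        simpa using ((hasDerivAt_id t).sub_const h).const_mul u
      exact (h1.sin.const_mul (-√(a/b))).congr_deriv (by rw [← hsq]; ring)
  have dS : ∀ t, HasDerivAt S (-gg a b (C t)) t := by
    intro t
    refine glue (G := fun t => -gg a b (C t)) hh hTh pS (fun t => by simp only [hper]) S1 S2
      (g1 := fun t => - (w * (w * Real.cos (w * t))))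
      (g2 := fun t => w * (u * Real.sin (u * (t - h)))) ?_ ?_ ?_ ?_ t
    · intro t ht
      have := nn t ht
      simp only [gg]
      rw [max_eq_left this, max_eq_right (by linarith), C1 t ht, ← hwa]; ring
    · intro t ht
      have := np t ht
      simp only [gg]
      rw [max_eq_right this, max_eq_left (by linarith), C2 t ht, ← hsq, ← hub]; ring
    · intro t _
      have h1 : HasDerivAt (fun t => w * t) w t := by simpa using (hasDerivAt_id t).const_mul w
      exact (h1.sin.const_mul w).neg.congr_deriv (by ring)
    · intro t _
      have h1 : HasDerivAt (fun t => u * (t - h)) u t := by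
        simpa using ((hasDerivAt_id t).sub_const h).const_mul u
      exact (h1.cos.const_mul w).neg.congr_deriv (by ring)
  refine ⟨S, hn0, ha0, hb, hh, hTh, dC, dS, hper, pS, ?_, pos, neg, ?_, ?_⟩
  · intro t
    have hd : ∀ t, HasDerivAt (fun t => HH a b (C t) (S t)) 0 t := fun t =>
      (hasDerivAt_HH a b (dC t) (dS t)).congr_deriv (by ring)
    have := is_const_of_deriv_eq_zero (fun t => (hd t).differentiableAt) (fun t => (hd t).deriv) t 0
    rw [this, C1 0 ⟨by linarith, hh.le⟩, S1 0 ⟨by linarith, hh.le⟩]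
    simp [HH]
  · rw [S1 h ⟨by linarith, le_rfl⟩]; simp [hwh]; exact hwdef
  · rw [S1 (-h) ⟨le_rfl, by linarith⟩]; simp [hwh]; exact hwdef


lemma gg_lip {a b : ℝ} (ha : 0 < a) (hb : 0 < b) (x y : ℝ) :
    |gg a b x - gg a b y| ≤ (a + b) * |x - y| := by
  have h1 := abs_max_sub_max_le_abs x y 0
  have h2 := abs_max_sub_max_le_abs (-x) (-y) 0
  have h3 : |(-x) - (-y)| = |x - y| := by rw [← abs_neg]; ring_nf
  rw [h3] at h2
  have : gg a b x - gg a b y = a * (max x 0 - max y 0) - b * (max (-x) 0 - max (-y) 0) := by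
    simp only [gg]; ring
  rw [this]
  refine (abs_sub _ _).trans ?_
  rw [abs_mul, abs_mul, abs_of_pos ha, abs_of_pos hb]
  nlinarith

lemma gg_hom {a b r x : ℝ} (hr : 0 ≤ r) : gg a b (r * x) = r * gg a b x := by
  have h1 : max (r * x) 0 = r * max x 0 := by rw [mul_max_of_nonneg _ _ hr, mul_zero]
  have h2 : max (-(r * x)) 0 = r * max (-x) 0 := by
    rw [mul_max_of_nonneg _ _ hr, mul_zero, mul_neg]
  simp only [gg, h1, h2]; ring

lemma HH_hom {a b r x v : ℝ} (hr : 0 ≤ r) : HH a b (r * x) (r * v) = r ^ 2 * HH a b x v := by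
  have h1 : max (r * x) 0 = r * max x 0 := by rw [mul_max_of_nonneg _ _ hr, mul_zero]
  have h2 : max (-(r * x)) 0 = r * max (-x) 0 := by
    rw [mul_max_of_nonneg _ _ hr, mul_zero, mul_neg]
  simp only [HH, h1, h2]; ring

lemma HH_eq (a b x v : ℝ) : HH a b x v = v ^ 2 + x * gg a b x := by
  rcases le_total 0 x with h | h
  · simp [HH, gg, h]; ring
  · simp [HH, gg, h]; ring

lemma gg_continuous (a b : ℝ) : Continuous (gg a b) := by
  unfold gg; fun_prop

lemma HH_v {a b x v : ℝ} (ha : 0 < a) (hb : 0 < b) : v ^ 2 ≤ HH a b x v := by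
  have : 0 ≤ a * (max x 0) ^ 2 := by positivity
  have : 0 ≤ b * (max (-x) 0) ^ 2 := by positivity
  simp only [HH]; linarith

lemma polar {n : ℕ} {a b h : ℝ} {C S : ℝ → ℝ} (A : ACos n a b h C S) {M : ℝ} (hM : 0 < M)
    {x v f : ℝ → ℝ} {ρ₀ τ₀ : ℝ} (hf : ContinuousOn f (Set.Icc (-(2 * π)) 0))
    (hfM : ∀ t ∈ Set.Icc (-(2 * π)) 0, |f t| ≤ M)
    (hx : ∀ t ∈ Set.Icc (-(2 * π)) 0, HasDerivAt x (v t) t)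
    (hv : ∀ t ∈ Set.Icc (-(2 * π)) 0, HasDerivAt v (f t - gg a b (x t)) t)
    (hρ₀ : 2 * π * M + 1 < √a * ρ₀) (hx0 : x 0 = ρ₀ * C τ₀) (hv0 : v 0 = ρ₀ * S τ₀) :
    ∃ ρ τ : ℝ → ℝ, ρ 0 = ρ₀ ∧ τ 0 = τ₀ ∧ ∀ t ∈ Set.Icc (-(2 * π)) 0,
      x t = ρ t * C (τ t) ∧ v t = ρ t * S (τ t) ∧ 0 < ρ t ∧
      HasDerivAt ρ (f t * S (τ t) / a) t ∧ HasDerivAt τ (1 - f t * C (τ t) / (a * ρ t)) t := by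
  have hπ := Real.pi_pos
  have ha := A.ha
  have hb := A.hb
  have hsa : 0 < √a := Real.sqrt_pos.2 ha
  have hρpos : 0 < ρ₀ := by
    by_contra hc
    push Not at hc
    have : √a * ρ₀ ≤ 0 := mul_nonpos_of_nonneg_of_nonpos hsa.le hc
    have : 0 < 2 * π * M := by positivity
    linarith
  set I := Set.Icc (-(2 * π)) (0:ℝ) with hI
  have h0I : (0:ℝ) ∈ I := ⟨by linarith, le_rfl⟩
  set H : ℝ → ℝ := fun t => HH a b (x t) (v t) with hHdef
  have dH : ∀ t ∈ I, HasDerivAt H (2 * f t * v t) t := fun t ht =>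
    (hasDerivAt_HH a b (hx t ht) (hv t ht)).congr_deriv (by ring)
  have hHnn : ∀ t, 0 ≤ H t := fun t => (sq_nonneg _).trans (HH_v ha hb)
  have hH0 : H 0 = a * ρ₀ ^ 2 := by
    simp only [H]; rw [hx0, hv0, HH_hom hρpos.le, A.en]; ring
  have hHpos : ∀ t ∈ I, 0 < H t := by
    have ds : ∀ t ∈ I, HasDerivWithinAt (fun t => √(H t + 1))
        (2 * f t * v t / (2 * √(H t + 1))) I t := fun t ht =>
      (((dH t ht).add_const 1).sqrt (by have := hHnn t; positivity)).hasDerivWithinAt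
    have bd : ∀ t ∈ I, ‖2 * f t * v t / (2 * √(H t + 1))‖ ≤ M := by
      intro t ht
      have h1 : |v t| ≤ √(H t + 1) := by
        apply Real.abs_le_sqrt
        have : v t ^ 2 ≤ H t := HH_v ha hb
        linarith
      have h2 : 0 < √(H t + 1) := Real.sqrt_pos.2 (by have := hHnn t; positivity)
      rw [Real.norm_eq_abs, abs_div, abs_of_pos (show 0 < 2 * √(H t + 1) by positivity),
        div_le_iff₀ (by positivity), abs_mul, abs_mul, abs_two]
      have := hfM t ht
      have := mul_le_mul this h1 (abs_nonneg _) hM.le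
      linarith
    intro t ht
    have := (convex_Icc (-(2*π)) (0:ℝ)).norm_image_sub_le_of_norm_hasDerivWithin_le ds bd ht h0I
    rw [Real.norm_eq_abs, Real.norm_eq_abs] at this
    have h3 : |0 - t| ≤ 2 * π := by rw [zero_sub, abs_neg, abs_of_nonpos ht.2]; linarith [ht.1]
    have h4 : √a * ρ₀ ≤ √(H 0 + 1) := by
      apply Real.le_sqrt_of_sq_le
      rw [hH0, mul_pow, Real.sq_sqrt ha.le]; linarith
    have h5 := (abs_le.1 this).2
    have h6 : M * |0 - t| ≤ M * (2 * π) := mul_le_mul_of_nonneg_left h3 hM.le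
    have h7 : 1 < √(H t + 1) := by linarith
    rw [Real.lt_sqrt (by norm_num)] at h7
    linarith
  have cx : ContinuousOn x I := HasDerivAt.continuousOn hx
  have cv : ContinuousOn v I := HasDerivAt.continuousOn hv
  have cH : ContinuousOn H I := HasDerivAt.continuousOn dH
  have cq : ContinuousOn (fun t => 1 - f t * x t / H t) I :=
    continuousOn_const.sub ((hf.mul cx).div cH fun t ht => (hHpos t ht).ne')
  have hle : -(2 * π) ≤ (0:ℝ) := by linarith
  set q : ℝ → ℝ := Set.IccExtend hle (I.domRestrict fun t => 1 - f t * x t / H t) with hq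
  have cqq : Continuous q := by
    apply Continuous.Icc_extend'
    exact cq.domRestrict
  have hqe : ∀ t ∈ I, q t = 1 - f t * x t / H t := by
    intro t ht
    rw [hq, Set.IccExtend_of_mem _ _ ht]; rfl
  set τ : ℝ → ℝ := fun t => τ₀ + ∫ s in (0:ℝ)..t, q s with hτ
  have dτ : ∀ t, HasDerivAt τ (q t) t := fun t =>
    (cqq.integral_hasStrictDerivAt 0 t).hasDerivAt.const_add τ₀
  set ρ : ℝ → ℝ := fun t => √(H t / a) with hρ
  have hρp : ∀ t ∈ I, 0 < ρ t := fun t ht => Real.sqrt_pos.2 (div_pos (hHpos t ht) ha)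
  have hρ2 : ∀ t, a * ρ t ^ 2 = H t := by
    intro t
    rw [hρ]; simp only
    rw [Real.sq_sqrt (div_nonneg (hHnn t) ha.le)]; field_simp
  have dρ : ∀ t ∈ I, HasDerivAt ρ (f t * v t / (a * ρ t)) t := by
    intro t ht
    refine (((dH t ht).div_const a).sqrt (div_pos (hHpos t ht) ha).ne').congr_deriv ?_
    have := hρp t ht
    change 2 * f t * v t / a / (2 * ρ t) = _
    field_simp
  have hρ0 : ρ 0 = ρ₀ := by
    rw [hρ]; simp only; rw [hH0, mul_div_cancel_left₀ _ ha.ne', Real.sqrt_sq hρpos.le]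
  have hτ0 : τ 0 = τ₀ := by simp [hτ]
  -- the ODE satisfied by both
  set W : ℝ → ℝ × ℝ → ℝ × ℝ := fun t z =>
    (z.2 + (f t / H t) * (v t * z.1 - x t * z.2),
      -gg a b z.1 + (f t / H t) * (v t * z.2 + x t * gg a b z.1)) with hW
  obtain ⟨B1, hB1⟩ := isCompact_Icc.exists_bound_of_continuousOn
    ((hf.div cH fun t ht => (hHpos t ht).ne').mul cv)
  obtain ⟨B2, hB2⟩ := isCompact_Icc.exists_bound_of_continuousOn
    ((hf.div cH fun t ht => (hHpos t ht).ne').mul cx)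
  have hB1nn : 0 ≤ B1 := (norm_nonneg _).trans (hB1 0 h0I)
  have hB2nn : 0 ≤ B2 := (norm_nonneg _).trans (hB2 0 h0I)
  set K : ℝ := 1 + B1 + B2 + (a + b) + B2 * (a + b) with hK
  have hKnn : 0 ≤ K := by positivity
  have hLip : ∀ t ∈ Set.Ioc (-(2 * π)) (0:ℝ), LipschitzOnWith K.toNNReal (W t) Set.univ := by
    intro t ht
    have htI : t ∈ I := ⟨ht.1.le, ht.2⟩
    have b1 := hB1 t htI
    have b2 := hB2 t htI
    simp only [Pi.mul_apply, Pi.div_apply, Real.norm_eq_abs] at b1 b2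
    apply LipschitzWith.lipschitzOnWith
    apply LipschitzWith.of_dist_le_mul
    intro z y
    rw [Real.coe_toNNReal _ hKnn]
    have e1 : |z.1 - y.1| ≤ dist z y := by
      rw [Prod.dist_eq, Real.dist_eq]; exact le_max_left _ _
    have e2 : |z.2 - y.2| ≤ dist z y := by
      rw [Prod.dist_eq, Real.dist_eq, Real.dist_eq]; exact le_max_right _ _
    have e3 := gg_lip ha hb z.1 y.1
    have e3' : |gg a b z.1 - gg a b y.1| ≤ (a + b) * dist z y :=
      e3.trans (mul_le_mul_of_nonneg_left e1 (by positivity))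
    set d := dist z y with hd
    have hdn : 0 ≤ d := dist_nonneg
    rw [Prod.dist_eq, Real.dist_eq, Real.dist_eq]
    apply max_le
    · have : (W t z).1 - (W t y).1 = (z.2 - y.2) + (f t / H t * v t) * (z.1 - y.1)
          - (f t / H t * x t) * (z.2 - y.2) := by simp only [hW]; ring
      rw [this]
      refine (abs_sub _ _).trans ((add_le_add_left (abs_add_le _ _) _).trans ?_)
      rw [abs_mul (f t / H t * v t), abs_mul (f t / H t * x t)]
      have t1 := mul_le_mul b1 e1 (abs_nonneg _) hB1nn
      have t2 := mul_le_mul b2 e2 (abs_nonneg _) hB2nn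
      have : K * d = d + B1 * d + B2 * d + (a + b) * d + B2 * (a + b) * d := by rw [hK]; ring
      have : 0 ≤ (a + b) * d := by positivity
      have : 0 ≤ B2 * (a + b) * d := by positivity
      linarith
    · have : (W t z).2 - (W t y).2 = -(gg a b z.1 - gg a b y.1) + (f t / H t * v t) * (z.2 - y.2)
          + (f t / H t * x t) * (gg a b z.1 - gg a b y.1) := by simp only [hW]; ring
      rw [this]
      refine (abs_add_le _ _).trans ((add_le_add_left (abs_add_le _ _) _).trans ?_)
      rw [abs_mul (f t / H t * v t), abs_mul (f t / H t * x t), abs_neg]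
      have t1 := mul_le_mul b1 e2 (abs_nonneg _) hB1nn
      have t2 := mul_le_mul b2 e3' (abs_nonneg _) hB2nn
      have : K * d = d + B1 * d + B2 * d + (a + b) * d + B2 * (a + b) * d := by rw [hK]; ring
      have : 0 ≤ B2 * d := by positivity
      linarith
  have d1 : ∀ t ∈ I, HasDerivAt (fun t => (x t, v t)) (W t (x t, v t)) t := by
    intro t ht
    refine ((hx t ht).prodMk (hv t ht)).congr_deriv ?_
    have hp := hHpos t ht
    have e : v t * v t + x t * gg a b (x t) = H t := by
      simp only [H]; rw [HH_eq]; ring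
    simp only [hW]
    rw [e]
    ext
    · simp; right; ring
    · simp; field_simp; ring
  have d2 : ∀ t ∈ I, HasDerivAt (fun t => (ρ t * C (τ t), ρ t * S (τ t)))
      (W t (ρ t * C (τ t), ρ t * S (τ t))) t := by
    intro t ht
    have hp := hHpos t ht
    have hr := hρp t ht
    have e1 := (dρ t ht).mul ((A.dC (τ t)).comp t (dτ t))
    have e2 := (dρ t ht).mul ((A.dS (τ t)).comp t (dτ t))
    refine (e1.prodMk e2).congr_deriv ?_
    simp only [hW, hqe t ht, ← hρ2 t, gg_hom hr.le, Function.comp]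
    ext
    · simp; field_simp; ring
    · simp; field_simp; ring
  have heq := ODE_solution_unique_of_mem_Icc_left (v := W) (s := fun _ => Set.univ) hLip
    (HasDerivAt.continuousOn d1)
    (fun t ht => (d1 t ⟨ht.1.le, ht.2⟩).hasDerivWithinAt) (fun _ _ => Set.mem_univ _)
    (HasDerivAt.continuousOn d2)
    (fun t ht => (d2 t ⟨ht.1.le, ht.2⟩).hasDerivWithinAt) (fun _ _ => Set.mem_univ _)
    (by rw [hρ0, hτ0, hx0, hv0])
  refine ⟨ρ, τ, hρ0, hτ0, fun t ht => ?_⟩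
  have e := heq ht
  simp only [Prod.mk.injEq] at e
  have hr := hρp t ht
  refine ⟨e.1, e.2, hr, (dρ t ht).congr_deriv ?_, (dτ t).congr_deriv ?_⟩
  · rw [e.2]; field_simp
  · rw [hqe t ht, ← hρ2 t, e.1]; field_simp


/-- two-valued sign -/
def sg (x : ℝ) : ℝ := if 0 < x then 1 else -1

/-- indicator of the set where `D` is small -/
def ZZ (D : ℝ → ℝ) (β t : ℝ) : ℝ := if |D t| ≤ β then 1 else 0

/-- averaged integrals -/
def QQ (p : ℝ → ℝ) (c : ℝ) (D F : ℝ → ℝ) (u w : ℝ) : ℝ :=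
  ∫ t in (-(2 * π))..0, (p t - c * sg (D (w + t))) * F (u + t)

lemma sg_measurable : Measurable sg :=
  Measurable.ite measurableSet_Ioi measurable_const measurable_const

lemma abs_sg (x : ℝ) : |sg x| = 1 := by unfold sg; split_ifs <;> simp

lemma ZZ_measurable {D : ℝ → ℝ} (hD : Continuous D) (β : ℝ) : Measurable (ZZ D β) :=
  Measurable.ite (measurableSet_le hD.abs.measurable measurable_const) measurable_const
    measurable_const

lemma ZZ_abs (D : ℝ → ℝ) (β t : ℝ) : |ZZ D β t| ≤ 1 := by
  unfold ZZ; split_ifs <;> simp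

lemma ZZ_nonneg (D : ℝ → ℝ) (β t : ℝ) : 0 ≤ ZZ D β t := by
  unfold ZZ; split_ifs <;> simp

lemma bdd_intervalIntegrable {f : ℝ → ℝ} {B : ℝ} (hf : Measurable f) (hB : ∀ t, |f t| ≤ B) (u v : ℝ) :
    IntervalIntegrable f volume u v := by
  refine (intervalIntegrable_const (c := B)).mono_fun' hf.aestronglyMeasurable ?_
  exact Eventually.of_forall fun t => hB t

namespace ACos
variable {n : ℕ} {a b h : ℝ} {C S : ℝ → ℝ}

lemma cC (A : ACos n a b h C S) : Continuous C :=
  continuous_iff_continuousAt.2 fun t => (A.dC t).continuousAt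
lemma cS (A : ACos n a b h C S) : Continuous S :=
  continuous_iff_continuousAt.2 fun t => (A.dS t).continuousAt

lemma per2 (A : ACos n a b h C S) {F : ℝ → ℝ} (hF : ∀ t, F (t + 2 * π / n) = F t) :
    Function.Periodic F (2 * π) := by
  have h1 : Function.Periodic F (2 * π / n) := hF
  have h2 := h1.nsmul n
  have hn := A.hn
  have : n • (2 * π / (n:ℝ)) = 2 * π := by rw [nsmul_eq_mul]; field_simp
  rwa [this] at h2

lemma bounds (A : ACos n a b h C S) : ∃ B : ℝ, 0 < B ∧ (∀ t, |C t| ≤ B) ∧ (∀ t, |S t| ≤ B) ∧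
    (∀ x y, |C x - C y| ≤ B * |x - y|) ∧ (∀ x y, |S x - S y| ≤ B * |x - y|) := by
  have ha := A.ha
  have hb := A.hb
  have h1 : ∀ t, |C t| ≤ 1 + a / b := by
    intro t
    have e := A.en t
    rw [HH] at e
    have e1 := sq_nonneg (S t)
    have hab : 0 < a / b := by positivity
    rcases le_total 0 (C t) with hc | hc
    · rw [max_eq_left hc, max_eq_right (by linarith)] at e
      rw [abs_of_nonneg hc]
      have : C t ^ 2 ≤ 1 := by
        by_contra hcon
        push Not at hcon
        nlinarith
      nlinarith
    · rw [max_eq_right hc, max_eq_left (by linarith)] at e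
      rw [abs_of_nonpos hc]
      have : (-C t) ^ 2 ≤ a / b := by
        rw [le_div_iff₀ hb]; nlinarith
      nlinarith [sq_nonneg (-C t - 1)]
  have h2 : ∀ t, |S t| ≤ √a := by
    intro t
    apply Real.abs_le_sqrt
    have := HH_v (a := a) (b := b) (x := C t) (v := S t) ha hb
    rwa [A.en] at this
  have h3 : ∀ t, |gg a b (C t)| ≤ (a + b) * (1 + a / b) := by
    intro t
    have := gg_lip ha hb (C t) 0
    simp only [gg, sub_zero, neg_zero, max_self, mul_zero] at this
    exact this.trans (mul_le_mul_of_nonneg_left (h1 t) (by positivity))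
  have p1 : 0 < 1 + a / b := by positivity
  have p2 : 0 ≤ √a := by positivity
  have p3 : 0 < (a + b) * (1 + a / b) := by positivity
  refine ⟨(1 + a / b) + √a + (a + b) * (1 + a / b), by positivity, ?_, ?_, ?_, ?_⟩
  · intro t; linarith [h1 t]
  · intro t; linarith [h2 t]
  · intro x y
    have := convex_univ.norm_image_sub_le_of_norm_hasDerivWithin_le (f := C) (f' := S)
      (fun t _ => (A.dC t).hasDerivWithinAt) (fun t _ => by
        rw [Real.norm_eq_abs]
        exact h2 t) (Set.mem_univ y) (Set.mem_univ x)
    rw [Real.norm_eq_abs, Real.norm_eq_abs] at this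
    refine this.trans (mul_le_mul_of_nonneg_right ?_ (abs_nonneg _))
    linarith
  · intro x y
    have := convex_univ.norm_image_sub_le_of_norm_hasDerivWithin_le (f := S)
      (f' := fun t => -gg a b (C t))
      (fun t _ => (A.dS t).hasDerivWithinAt) (fun t _ => by
        rw [Real.norm_eq_abs, abs_neg]
        exact h3 t) (Set.mem_univ y) (Set.mem_univ x)
    rw [Real.norm_eq_abs, Real.norm_eq_abs] at this
    refine this.trans (mul_le_mul_of_nonneg_right ?_ (abs_nonneg _))
    linarith

lemma zeros_countable (A : ACos n a b h C S) : {t | C t = 0}.Countable := by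
  have hT0 : 0 < 2 * π / n := by linarith [A.hhT, A.hh]
  have PC : Function.Periodic C (2 * π / n) := A.pC
  have : {t | C t = 0} ⊆ ⋃ k : ℤ, ({-h + k • (2 * π / n), h + k • (2 * π / n)} : Set ℝ) := by
    intro t ht
    rw [Set.mem_iUnion]
    refine ⟨toIcoDiv hT0 (-h) t, ?_⟩
    have hr := toIcoMod_mem_Ico hT0 (-h) t
    have e : C (toIcoMod hT0 (-h) t) = 0 := by
      rw [toIcoMod, PC.sub_zsmul_eq]; exact ht
    have e2 : toIcoMod hT0 (-h) t + toIcoDiv hT0 (-h) t • (2 * π / n) = t :=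
      toIcoMod_add_toIcoDiv_zsmul hT0 (-h) t
    set r := toIcoMod hT0 (-h) t
    rcases eq_or_lt_of_le hr.1 with h1 | h1
    · left; linarith
    rcases lt_trichotomy r h with h2 | h2 | h2
    · exact absurd e (A.pos r ⟨h1, h2⟩).ne'
    · right; rw [Set.mem_singleton_iff]; linarith
    · exact absurd e (A.neg r ⟨h2, by linarith [hr.2]⟩).ne
  refine Set.Countable.mono this (Set.countable_iUnion fun k => ?_)
  exact (Set.toFinite _).countable

lemma ZZ_small (A : ACos n a b h C S) {ε : ℝ} (hε : 0 < ε) :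
    ∃ β > 0, ∀ w, ∫ t in (-(2 * π))..0, ZZ C β (w + t) ≤ ε := by
  have lim : Tendsto (fun k : ℕ => ∫ t in (-(2 * π))..0, ZZ C (1 / ((k : ℝ) + 1)) t) atTop
      (nhds (∫ t in (-(2 * π))..0, (0:ℝ))) := by
    refine intervalIntegral.tendsto_integral_filter_of_dominated_convergence (fun _ => 1)
      (Eventually.of_forall fun k => (ZZ_measurable A.cC _).aestronglyMeasurable)
      (Eventually.of_forall fun k => Eventually.of_forall fun t _ => ZZ_abs _ _ _)
      intervalIntegrable_const ?_
    have : ∀ᵐ t, C t ≠ 0 := by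
      rw [ae_iff]; simpa using A.zeros_countable.measure_zero volume
    filter_upwards [this] with t ht _
    have hpos : 0 < |C t| := abs_pos.2 ht
    have h1 := tendsto_one_div_add_atTop_nhds_zero_nat (𝕜 := ℝ)
    refine tendsto_const_nhds.congr' ?_
    filter_upwards [h1.eventually (gt_mem_nhds hpos)] with k hk
    unfold ZZ
    rw [if_neg (by linarith)]
  rw [intervalIntegral.integral_zero] at lim
  obtain ⟨k, hk⟩ := (lim.eventually (gt_mem_nhds hε)).exists
  refine ⟨1 / ((k:ℝ) + 1), by positivity, fun w => ?_⟩
  have per : Function.Periodic (ZZ C (1 / ((k : ℝ) + 1))) (2 * π) := by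
    intro t; unfold ZZ; rw [A.per2 A.pC t]
  have e := per.intervalIntegral_add_eq (w + -(2 * π)) (-(2 * π))
  rw [intervalIntegral.integral_comp_add_left (fun s => ZZ C (1 / ((k : ℝ) + 1)) s) w]
  have e1 : w + -(2 * π) + 2 * π = w + 0 := by ring
  have e2 : -(2 * π) + 2 * π = 0 := by ring
  rw [e1, e2] at e
  rw [e]; exact hk.le

end ACos

lemma int_err {n : ℕ} {a b h : ℝ} {C S : ℝ → ℝ} (A : ACos n a b h C S) {err : ℝ → ℝ}
    {c1 c2 β w ε : ℝ} (hc2 : 0 ≤ c2)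
    (herr : ∀ t ∈ Set.Icc (-(2 * π)) 0, |err t| ≤ c1 + c2 * ZZ C β (w + t))
    (hZ : ∫ t in (-(2 * π))..0, ZZ C β (w + t) ≤ ε) :
    |∫ t in (-(2 * π))..0, err t| ≤ 2 * π * c1 + c2 * ε := by
  have hπ := Real.pi_pos
  have hm : Measurable fun t => ZZ C β (w + t) :=
    (ZZ_measurable A.cC β).comp (measurable_const_add w)
  have hi := bdd_intervalIntegrable hm (fun t => ZZ_abs C β (w + t)) (-(2*π)) 0
  have := intervalIntegral.norm_integral_le_of_norm_le (μ := volume) (a := -(2*π)) (b := 0) (f := err)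
    (g := fun t => c1 + c2 * ZZ C β (w + t)) (by linarith)
    (Eventually.of_forall fun t ht => herr t ⟨ht.1.le, ht.2⟩)
    (intervalIntegrable_const.add (hi.const_mul c2))
  rw [Real.norm_eq_abs] at this
  refine this.trans ?_
  rw [intervalIntegral.integral_add intervalIntegrable_const (hi.const_mul c2),
    intervalIntegral.integral_const, intervalIntegral.integral_const_mul]
  have := mul_le_mul_of_nonneg_left hZ hc2
  simp only [smul_eq_mul]
  linarith

lemma phi_pt {n : ℕ} {a b h : ℝ} {C S : ℝ → ℝ} (A : ACos n a b h C S) {φ : ℝ → ℝ} {c M : ℝ}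
    (hM : ∀ x, |φ x| ≤ M) (htop : Tendsto φ atTop (nhds c)) (hbot : Tendsto φ atBot (nhds (-c)))
    {ν β : ℝ} (hν : 0 < ν) (hβ : 0 < β) :
    ∃ R > 0, ∃ κ > 0, ∀ r ≥ R, ∀ y y0, |y - y0| ≤ κ →
      |φ (r * C y) - c * sg (C y0)| ≤ ν + 2 * M * ZZ C β y0 := by
  obtain ⟨B, hB, -, -, hL, -⟩ := A.bounds
  have hcM : |c| ≤ M := le_of_tendsto htop.abs (Eventually.of_forall hM)
  have hM0 : 0 ≤ M := (abs_nonneg _).trans hcM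
  obtain ⟨T1, hT1⟩ := eventually_atTop.1 (htop.eventually (Metric.closedBall_mem_nhds c hν))
  obtain ⟨T2, hT2⟩ := eventually_atBot.1 (hbot.eventually (Metric.closedBall_mem_nhds (-c) hν))
  set T := |T1| + |T2| + 1
  have hT : 0 < T := by positivity
  have hTT1 : T1 ≤ T := by
    have := le_abs_self T1; have := abs_nonneg T2; simp only [T]; linarith
  have hTT2 : -T ≤ T2 := by
    have := neg_abs_le T2; have := abs_nonneg T1; simp only [T]; linarith
  refine ⟨T / (β / 2), by positivity, β / (2 * B), by positivity, fun r hr y y0 hy => ?_⟩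
  have hr0 : 0 < r := lt_of_lt_of_le (by positivity) hr
  by_cases hz : |C y0| ≤ β
  · have : ZZ C β y0 = 1 := by unfold ZZ; rw [if_pos hz]
    rw [this]
    refine (abs_sub _ _).trans ?_
    rw [abs_mul, abs_sg]
    linarith [hM (r * C y)]
  · have : ZZ C β y0 = 0 := by unfold ZZ; rw [if_neg hz]
    rw [this, mul_zero, add_zero]
    push Not at hz
    have h1 := (hL y y0).trans (mul_le_mul_of_nonneg_left hy hB.le)
    have h2 : B * (β / (2 * B)) = β / 2 := by field_simp
    rw [h2] at h1
    have h1 := abs_le.1 h1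
    have hr' : T ≤ r * (β / 2) := by
      rw [ge_iff_le, div_le_iff₀ (by positivity)] at hr; exact hr
    rcases lt_abs.1 hz with h3 | h3
    · have e : sg (C y0) = 1 := by unfold sg; rw [if_pos (by linarith)]
      have : β / 2 ≤ C y := by linarith [h1.1]
      have h4 : T1 ≤ r * C y := by
        have := mul_le_mul_of_nonneg_left this hr0.le
        linarith
      have := hT1 _ h4
      rw [Real.dist_eq] at this
      rw [e, mul_one]; exact this
    · have e : sg (C y0) = -1 := by unfold sg; rw [if_neg (by linarith)]
      have : C y ≤ -(β / 2) := by linarith [h1.2]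
      have h4 : r * C y ≤ T2 := by
        have := mul_le_mul_of_nonneg_left this hr0.le
        linarith
      have := hT2 _ h4
      rw [Real.dist_eq] at this
      rw [e, mul_neg, mul_one]; exact this


lemma slow {n : ℕ} {a b h : ℝ} {C S : ℝ → ℝ} (A : ACos n a b h C S) {M B : ℝ} (hM : 0 < M)
    (hB : 0 < B) (hC : ∀ t, |C t| ≤ B) (hS : ∀ t, |S t| ≤ B) {f ρ τ : ℝ → ℝ}
    (hfM : ∀ t ∈ Set.Icc (-(2 * π)) 0, |f t| ≤ M)
    (hd : ∀ t ∈ Set.Icc (-(2 * π)) 0, 0 < ρ t ∧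
      HasDerivAt ρ (f t * S (τ t) / a) t ∧ HasDerivAt τ (1 - f t * C (τ t) / (a * ρ t)) t)
    (hR : 2 * (M * B / a * (2 * π)) ≤ ρ 0) :
    ∀ t ∈ Set.Icc (-(2 * π)) 0, |ρ t - ρ 0| ≤ M * B / a * (2 * π) ∧ ρ 0 / 2 ≤ ρ t ∧
      |τ t - (τ 0 + t)| ≤ 2 * (M * B / a * (2 * π)) / ρ 0 := by
  have hπ := Real.pi_pos
  have ha := A.ha
  have hc : 0 < M * B / a * (2 * π) := by positivity
  have hρ0 : 0 < ρ 0 := by linarith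
  have h0I : (0:ℝ) ∈ Set.Icc (-(2 * π)) (0:ℝ) := ⟨by linarith, le_rfl⟩
  have h1 : ∀ t ∈ Set.Icc (-(2 * π)) 0, |ρ t - ρ 0| ≤ M * B / a * (2 * π) := by
    intro t ht
    have := (convex_Icc (-(2*π)) (0:ℝ)).norm_image_sub_le_of_norm_hasDerivWithin_le
      (f := ρ) (f' := fun t => f t * S (τ t) / a) (C := M * B / a)
      (fun t ht => (hd t ht).2.1.hasDerivWithinAt) (fun t ht => by
        rw [Real.norm_eq_abs, abs_div, abs_mul, abs_of_pos ha]
        exact div_le_div_of_nonneg_right (mul_le_mul (hfM t ht) (hS _) (abs_nonneg _) hM.le) ha.le)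
        h0I ht
    rw [Real.norm_eq_abs, Real.norm_eq_abs] at this
    refine this.trans (mul_le_mul_of_nonneg_left ?_ (by positivity))
    rw [sub_zero, abs_of_nonpos ht.2]; linarith [ht.1]
  have h2 : ∀ t ∈ Set.Icc (-(2 * π)) 0, ρ 0 / 2 ≤ ρ t := by
    intro t ht
    have := (abs_le.1 (h1 t ht)).1
    linarith
  intro t ht
  refine ⟨h1 t ht, h2 t ht, ?_⟩
  have := (convex_Icc (-(2*π)) (0:ℝ)).norm_image_sub_le_of_norm_hasDerivWithin_le
      (f := fun t => τ t - t) (f' := fun t => 1 - f t * C (τ t) / (a * ρ t) - 1)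
      (C := M * B / (a * (ρ 0 / 2)))
      (fun t ht => ((hd t ht).2.2.sub (hasDerivAt_id t)).hasDerivWithinAt) (fun t ht => by
        rw [Real.norm_eq_abs, sub_sub_cancel_left, abs_neg, abs_div, abs_mul,
          abs_of_pos (mul_pos ha (hd t ht).1)]
        exact div_le_div₀ (by positivity) (mul_le_mul (hfM t ht) (hC _) (abs_nonneg _) hM.le)
          (by positivity) (mul_le_mul_of_nonneg_left (h2 t ht) ha.le))
        h0I ht
  rw [Real.norm_eq_abs, Real.norm_eq_abs] at this
  have e : τ t - t - (τ 0 - 0) = τ t - (τ 0 + t) := by ring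
  rw [e] at this
  refine this.trans ((mul_le_mul_of_nonneg_left (b := |t - 0|) (c := 2 * π) ?_ (by positivity)).trans
    (le_of_eq ?_))
  · rw [sub_zero, abs_of_nonpos ht.2]; linarith [ht.1]
  · field_simp

lemma QQ_integrable {n : ℕ} {a b h : ℝ} {C S : ℝ → ℝ} (A : ACos n a b h C S) {p : ℝ → ℝ}
    (hp : Continuous p) {F : ℝ → ℝ} (hF : Continuous F) (c u w x y : ℝ) :
    IntervalIntegrable (fun t => (p t - c * sg (C (w + t))) * F (u + t)) volume x y := by
  have h1 : IntervalIntegrable (fun t => p t - c * sg (C (w + t))) volume x y := by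
    refine (hp.intervalIntegrable x y).sub (IntervalIntegrable.const_mul ?_ c)
    refine bdd_intervalIntegrable (B := 1) ?_ (fun t => (abs_sg _).le) x y
    exact sg_measurable.comp (A.cC.comp (continuous_const_add w)).measurable
  exact h1.mul_continuousOn (hF.comp (continuous_const_add u)).continuousOn

lemma avg {n : ℕ} {a b h a' b' h' : ℝ} {C S C' S' : ℝ → ℝ} (A : ACos n a b h C S)
    (A' : ACos n a' b' h' C' S') {M : ℝ} (hM : 0 < M) {p : ℝ → ℝ} (hp : Continuous p)
    {φ : ℝ → ℝ} {c : ℝ} (hφM : ∀ x, |φ x| ≤ M)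
    (htop : Tendsto φ atTop (nhds c)) (hbot : Tendsto φ atBot (nhds (-c)))
    {ε : ℝ} (hε : 0 < ε) :
    ∃ R > 0, ∀ f f' ρ τ ρ' τ' : ℝ → ℝ, ContinuousOn f (Set.Icc (-(2 * π)) 0) →
      (∀ t ∈ Set.Icc (-(2 * π)) 0, |f t| ≤ M) → (∀ t ∈ Set.Icc (-(2 * π)) 0, |f' t| ≤ M) →
      (∀ t ∈ Set.Icc (-(2 * π)) 0, f t = p t - φ (ρ' t * C' (τ' t))) →
      (∀ t ∈ Set.Icc (-(2 * π)) 0, 0 < ρ t ∧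
        HasDerivAt ρ (f t * S (τ t) / a) t ∧ HasDerivAt τ (1 - f t * C (τ t) / (a * ρ t)) t) →
      (∀ t ∈ Set.Icc (-(2 * π)) 0, 0 < ρ' t ∧
        HasDerivAt ρ' (f' t * S' (τ' t) / a') t ∧
        HasDerivAt τ' (1 - f' t * C' (τ' t) / (a' * ρ' t)) t) →
      R ≤ ρ 0 → R ≤ ρ' 0 →
      (∀ t ∈ Set.Icc (-(2 * π)) 0, ρ 0 / 2 ≤ ρ t) ∧
      |a * (ρ (-(2 * π)) - ρ 0) + QQ p c C' S (τ 0) (τ' 0)| ≤ ε ∧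
      |a * ρ 0 * (τ (-(2 * π)) + 2 * π - τ 0) - QQ p c C' C (τ 0) (τ' 0)| ≤ ε := by
  have hπ := Real.pi_pos
  have ha := A.ha
  have ha' := A'.ha
  obtain ⟨B, hB, hC, hS, hCL, hSL⟩ := A.bounds
  obtain ⟨B', hB', hC', hS', -, -⟩ := A'.bounds
  obtain ⟨β, hβ, hZ⟩ := A'.ZZ_small (ε := ε / (4 * (B * M))) (by positivity)
  obtain ⟨R1, hR1, κ, hκ, hφ⟩ := phi_pt A' hφM htop hbot (ν := ε / (8 * π * B)) (by positivity) hβ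
  set d := M * B / a * (2 * π) with hd
  set d' := M * B' / a' * (2 * π) with hd'
  have hdp : 0 < d := by positivity
  have hdp' : 0 < d' := by positivity
  refine ⟨2 * d + 2 * d' + 2 * R1 + 2 * d' / κ + (4 * M * B * d) * (8 * π) / ε , by positivity, ?_⟩
  intro f f' ρ τ ρ' τ' cf hfM hfM' hf hdd hdd' hR hR'
  have q1 : 0 < 2 * d' / κ := by positivity
  have q2 : 0 < (4 * M * B * d) * (8 * π) / ε := by positivity
  have sl := slow A hM hB hC hS hfM hdd (by rw [← hd]; linarith)
  have sl' := slow A' hM hB' hC' hS' hfM' hdd' (by rw [← hd']; linarith)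
  rw [← hd] at sl
  rw [← hd'] at sl'
  have hρ0 : 0 < ρ 0 := by linarith
  have hρ0' : 0 < ρ' 0 := by linarith
  have hsmall : 4 * M * B * d / ρ 0 ≤ ε / (8 * π) := by
    rw [div_le_div_iff₀ hρ0 (by positivity)]
    have : (4 * M * B * d) * (8 * π) / ε ≤ ρ 0 := by linarith
    rw [div_le_iff₀ hε] at this
    linarith
  have hff : ∀ t ∈ Set.Icc (-(2 * π)) 0, |f t - (p t - c * sg (C' (τ' 0 + t)))| ≤
      ε / (8 * π * B) + 2 * M * ZZ C' β (τ' 0 + t) := by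
    intro t ht
    have s := sl' t ht
    have := hφ (ρ' t) (by linarith [s.2.1]) (τ' t) (τ' 0 + t) (s.2.2.trans (by
      rw [div_le_iff₀ hρ0']
      have hk : 2 * d' / κ ≤ ρ' 0 := by linarith
      rw [div_le_iff₀ hκ] at hk
      linarith))
    rw [hf t ht]
    have e : p t - φ (ρ' t * C' (τ' t)) - (p t - c * sg (C' (τ' 0 + t))) =
      - (φ (ρ' t * C' (τ' t)) - c * sg (C' (τ' 0 + t))) := by ring
    rw [e, abs_neg]; exact this
  have hle : -(2 * π) ≤ (0:ℝ) := by linarith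
  have cρ : ContinuousOn ρ (Set.Icc (-(2 * π)) 0) := HasDerivAt.continuousOn fun t ht => (hdd t ht).2.1
  have cτ : ContinuousOn τ (Set.Icc (-(2 * π)) 0) := HasDerivAt.continuousOn fun t ht => (hdd t ht).2.2
  have cST : ContinuousOn (fun t => f t * S (τ t)) (Set.Icc (-(2 * π)) 0) :=
    cf.mul (A.cS.comp_continuousOn cτ)
  have cCT : ContinuousOn (fun t => f t * C (τ t) / (a * ρ t)) (Set.Icc (-(2 * π)) 0) :=
    (cf.mul (A.cC.comp_continuousOn cτ)).div (continuousOn_const.mul cρ)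
      fun t ht => (mul_pos ha (hdd t ht).1).ne'
  have hb1 : B * (ε / (8 * π * B)) = ε / (8 * π) := by field_simp
  -- generic estimate
  have gen : ∀ F : ℝ → ℝ, (∀ t, |F t| ≤ B) → (∀ x y, |F x - F y| ≤ B * |x - y|) →
      ∀ t ∈ Set.Icc (-(2 * π)) 0,
      |f t * F (τ t) - (p t - c * sg (C' (τ' 0 + t))) * F (τ 0 + t)| ≤
        (ε / (8 * π) + M * B * (2 * d / ρ 0)) + (2 * B * M) * ZZ C' β (τ' 0 + t) := by
    intro F hF hFL t ht
    have e : f t * F (τ t) - (p t - c * sg (C' (τ' 0 + t))) * F (τ 0 + t) =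
      f t * (F (τ t) - F (τ 0 + t)) + (f t - (p t - c * sg (C' (τ' 0 + t)))) * F (τ 0 + t) := by ring
    rw [e]
    refine (abs_add_le _ _).trans ?_
    rw [abs_mul, abs_mul]
    have t1 := mul_le_mul (hfM t ht) ((hFL (τ t) (τ 0 + t)).trans
      (mul_le_mul_of_nonneg_left (sl t ht).2.2 hB.le)) (abs_nonneg _) hM.le
    have hz := ZZ_nonneg C' β (τ' 0 + t)
    have t2 := mul_le_mul (hff t ht) (hF (τ 0 + t)) (abs_nonneg _) (by positivity)
    have t3 : (ε / (8 * π * B) + 2 * M * ZZ C' β (τ' 0 + t)) * B =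
      B * (ε / (8 * π * B)) + (2 * B * M) * ZZ C' β (τ' 0 + t) := by ring
    rw [t3, hb1] at t2
    linarith
  have hq : M * B * (2 * d / ρ 0) = 4 * M * B * d / ρ 0 / 2 := by ring
  have hfin : 2 * π * (ε / (8 * π) + 4 * M * B * d / ρ 0) + (2 * B * M) * (ε / (4 * (B * M))) ≤ ε := by
    have : 2 * π * (ε / (8 * π) + 4 * M * B * d / ρ 0) ≤ 2 * π * (ε / (8 * π) + ε / (8 * π)) :=
      mul_le_mul_of_nonneg_left (by linarith) (by positivity)
    have e1 : 2 * π * (ε / (8 * π) + ε / (8 * π)) = ε / 2 := by field_simp; ring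
    have e2 : (2 * B * M) * (ε / (4 * (B * M))) = ε / 2 := by field_simp; ring
    linarith
  have hq3 : 0 < 4 * M * B * d / ρ 0 := by positivity
  refine ⟨fun t ht => (sl t ht).2.1, ?_, ?_⟩
  · have ftc := intervalIntegral.integral_eq_sub_of_hasDerivAt_of_le hle cρ
      (fun t ht => (hdd t ⟨ht.1.le, ht.2.le⟩).2.1)
      ((cST.div_const a).intervalIntegrable_of_Icc hle)
    rw [intervalIntegral.integral_div] at ftc
    have e : a * (ρ (-(2 * π)) - ρ 0) + QQ p c C' S (τ 0) (τ' 0) =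
        - ∫ t in (-(2 * π))..0, (f t * S (τ t) -
          (p t - c * sg (C' (τ' 0 + t))) * S (τ 0 + t)) := by
      rw [intervalIntegral.integral_sub (cST.intervalIntegrable_of_Icc hle)
        (QQ_integrable A' hp A.cS c (τ 0) (τ' 0) _ _)]
      rw [div_eq_iff ha.ne'] at ftc
      rw [ftc, QQ]; ring
    rw [e, abs_neg]
    refine (int_err A' (by positivity) (gen S hS hSL) (hZ _)).trans (le_trans ?_ hfin)
    gcongr
    rw [hq]; linarith
  · have ftc := intervalIntegral.integral_eq_sub_of_hasDerivAt_of_le hle cτ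
      (fun t ht => (hdd t ⟨ht.1.le, ht.2.le⟩).2.2)
      ((continuousOn_const.sub cCT).intervalIntegrable_of_Icc hle)
    rw [intervalIntegral.integral_sub intervalIntegrable_const
      (cCT.intervalIntegrable_of_Icc hle), intervalIntegral.integral_const] at ftc
    have e : a * ρ 0 * (τ (-(2 * π)) + 2 * π - τ 0) - QQ p c C' C (τ 0) (τ' 0) =
        ∫ t in (-(2 * π))..0, (a * ρ 0 * (f t * C (τ t) / (a * ρ t)) -
          (p t - c * sg (C' (τ' 0 + t))) * C (τ 0 + t)) := by
      rw [intervalIntegral.integral_sub ((cCT.intervalIntegrable_of_Icc hle).const_mul _)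
        (QQ_integrable A' hp A.cC c (τ 0) (τ' 0) _ _), intervalIntegral.integral_const_mul, ← QQ]
      have : ∫ t in (-(2 * π))..0, f t * C (τ t) / (a * ρ t) = τ (-(2 * π)) + 2 * π - τ 0 := by
        simp only [smul_eq_mul] at ftc
        linarith
      rw [this]
    rw [e]
    refine (int_err (c1 := ε / (8 * π) + 4 * M * B * d / ρ 0) A' (by positivity) ?_ (hZ (τ' 0))).trans hfin
    intro t ht
    have g := gen C hC hCL t ht
    have hr := (hdd t ht).1
    have e : a * ρ 0 * (f t * C (τ t) / (a * ρ t)) -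
          (p t - c * sg (C' (τ' 0 + t))) * C (τ 0 + t) =
        (f t * C (τ t) - (p t - c * sg (C' (τ' 0 + t))) * C (τ 0 + t)) +
        f t * C (τ t) * ((ρ 0 - ρ t) / ρ t) := by field_simp; ring
    rw [e]
    refine (abs_add_le _ _).trans ?_
    have t4 : |f t * C (τ t) * ((ρ 0 - ρ t) / ρ t)| ≤ M * B * (d / (ρ 0 / 2)) := by
      rw [abs_mul, abs_mul]
      refine mul_le_mul (mul_le_mul (hfM t ht) (hC _) (abs_nonneg _) hM.le) ?_ (abs_nonneg _)
        (by positivity)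
      rw [abs_div, abs_of_pos hr, abs_sub_comm]
      exact div_le_div₀ hdp.le (sl t ht).1 (by positivity) (sl t ht).2.1
    have t5 : M * B * (d / (ρ 0 / 2)) = 4 * M * B * d / ρ 0 / 2 := by field_simp; ring
    rw [hq] at g
    linarith


lemma sign_integral {n : ℕ} {a b h : ℝ} {C S F : ℝ → ℝ} (A : ACos n a b h C S) (cF : Continuous F)
    (pF : ∀ t, F (t + 2 * π / n) = F t) (u w : ℝ) :
    ∫ t in (-(2 * π))..0, sg (C (w + t)) * F (u + t) =
      n * (2 * (∫ t in (u - w - h)..(u - w + h), F t) - ∫ t in (0:ℝ)..(2 * π / n), F t) := by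
  have hn := A.hn
  have hh := A.hh
  have hhT := A.hhT
  set T := 2 * π / n with hT
  set δ := u - w with hδ
  set G : ℝ → ℝ := fun t => sg (C t) * F (δ + t) with hG
  have pG : Function.Periodic G T := by
    intro t
    simp only [hG]
    rw [A.pC t, ← add_assoc, pF]
  have pG2 : Function.Periodic G (2 * π) := A.per2 pG
  have hgi : ∀ x y, IntervalIntegrable G volume x y := by
    intro x y
    refine IntervalIntegrable.mul_continuousOn ?_ (cF.comp (continuous_const_add δ)).continuousOn
    exact bdd_intervalIntegrable (sg_measurable.comp A.cC.measurable) (fun t => (abs_sg _).le) x y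
  have hFi : ∀ x y, IntervalIntegrable (fun t => F (δ + t)) volume x y := fun x y =>
    (cF.comp (continuous_const_add δ)).intervalIntegrable x y
  have e1 : ∫ t in (-(2 * π))..0, sg (C (w + t)) * F (u + t) = ∫ t in (-h)..(-h + 2 * π), G t := by
    rw [← pG2.intervalIntegral_add_eq (w + -(2 * π)) (-h)]
    have := intervalIntegral.integral_comp_add_left G w (a := -(2 * π)) (b := 0)
    have e : w + -(2 * π) + 2 * π = w + 0 := by ring
    rw [e, ← this]
    refine intervalIntegral.integral_congr fun t _ => ?_
    simp only [hG, hδ]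
    congr 2; ring
  have e2 : ∫ t in (-h)..(-h + 2 * π), G t = n * ∫ t in (-h)..(-h + T), G t := by
    have := pG.intervalIntegral_add_zsmul_eq n (-h) hgi
    have e : ((n : ℤ) • T : ℝ) = 2 * π := by
      rw [hT]; simp; field_simp
    rw [e] at this
    rw [this]; simp
  have e3 : ∫ t in (-h)..(-h + T), G t = (∫ t in (-h)..h, G t) + ∫ t in h..(-h+T), G t :=
    (intervalIntegral.integral_add_adjacent_intervals (hgi _ _) (hgi _ _)).symm
  have ne : ∀ z : ℝ, ∀ᵐ t : ℝ, t ≠ z := fun z => by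
    rw [ae_iff]; simp
  have e4 : ∫ t in (-h)..h, G t = ∫ t in (-h)..h, F (δ + t) := by
    refine intervalIntegral.integral_congr_ae ?_
    filter_upwards [ne h] with t ht hm
    rw [Set.uIoc_of_le (by linarith)] at hm
    have := A.pos t ⟨hm.1, lt_of_le_of_ne hm.2 ht⟩
    simp only [hG, sg]
    rw [if_pos this, one_mul]
  have e5 : ∫ t in h..(-h+T), G t = -∫ t in h..(-h+T), F (δ + t) := by
    rw [← intervalIntegral.integral_neg]
    refine intervalIntegral.integral_congr_ae ?_
    filter_upwards [ne (-h + T)] with t ht hm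
    rw [Set.uIoc_of_le (by linarith)] at hm
    have := A.neg t ⟨hm.1, by have := lt_of_le_of_ne hm.2 ht; linarith⟩
    simp only [hG, sg]
    rw [if_neg (by linarith)]; ring
  have e6 : (∫ t in (-h)..h, F (δ + t)) + ∫ t in h..(-h+T), F (δ + t) = ∫ t in (0:ℝ)..T, F t := by
    rw [intervalIntegral.integral_add_adjacent_intervals (hFi _ _) (hFi _ _),
      intervalIntegral.integral_comp_add_left F δ]
    have := Function.Periodic.intervalIntegral_add_eq (f := F) (T := T) pF (δ + -h) 0
    rw [zero_add] at this
    rw [← this]; congr 1; ring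
  have e7 : ∫ t in (-h)..h, F (δ + t) = ∫ t in (δ - h)..(δ + h), F t := by
    rw [intervalIntegral.integral_comp_add_left F δ]; rfl
  rw [e1, e2, e3, e4, e5, ← e7]
  congr 1; linarith

lemma int_S {n : ℕ} {a b h : ℝ} {C S : ℝ → ℝ} (A : ACos n a b h C S) (x y : ℝ) :
    ∫ t in x..y, S t = C y - C x :=
  intervalIntegral.integral_eq_sub_of_hasDerivAt (fun t _ => A.dC t) (A.cS.intervalIntegrable _ _)

lemma int_C {n : ℕ} {a b h : ℝ} {C S : ℝ → ℝ} (A : ACos n a b h C S) :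
    ∫ t in (0:ℝ)..(2 * π / n), C t = 2 * (1 / √a - √a / b) := by
  have hh := A.hh
  have hhT := A.hhT
  have ha := A.ha
  have hb := A.hb
  set T := 2 * π / n with hT
  have hci := fun x y : ℝ => A.cC.intervalIntegrable (μ := volume) x y
  have hgi : ∀ x y : ℝ, IntervalIntegrable (fun t => -gg a b (C t)) volume x y := fun x y =>
    ((gg_continuous a b).comp A.cC).neg.intervalIntegrable x y
  have e0 : ∫ t in (0:ℝ)..T, C t = (∫ t in (-h)..h, C t) + ∫ t in h..(-h+T), C t := by
    rw [intervalIntegral.integral_add_adjacent_intervals (hci _ _) (hci _ _)]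
    have := Function.Periodic.intervalIntegral_add_eq (f := C) (T := T) A.pC (-h) 0
    rw [this, zero_add]
  have ne : ∀ z : ℝ, ∀ᵐ t : ℝ, t ≠ z := fun z => by
    rw [ae_iff]; simp
  have e1 : ∫ t in (-h)..h, C t = -(1 / a) * ∫ t in (-h)..h, -gg a b (C t) := by
    rw [← intervalIntegral.integral_const_mul]
    refine intervalIntegral.integral_congr_ae ?_
    filter_upwards [ne h] with t ht hm
    rw [Set.uIoc_of_le (by linarith)] at hm
    have := A.pos t ⟨hm.1, lt_of_le_of_ne hm.2 ht⟩
    simp only [gg]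
    rw [max_eq_left this.le, max_eq_right (by linarith)]; field_simp; ring
  have e2 : ∫ t in h..(-h+T), C t = -(1 / b) * ∫ t in h..(-h+T), -gg a b (C t) := by
    rw [← intervalIntegral.integral_const_mul]
    refine intervalIntegral.integral_congr_ae ?_
    filter_upwards [ne (-h + T)] with t ht hm
    rw [Set.uIoc_of_le (by linarith)] at hm
    have := A.neg t ⟨hm.1, by have := lt_of_le_of_ne hm.2 ht; linarith⟩
    simp only [gg]
    rw [max_eq_right this.le, max_eq_left (by linarith)]; field_simp; ring
  have f : ∀ x y : ℝ, ∫ t in x..y, -gg a b (C t) = S y - S x := fun x y =>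
    intervalIntegral.integral_eq_sub_of_hasDerivAt (fun t _ => A.dS t) (hgi _ _)
  have hs : √a * √a = a := Real.mul_self_sqrt ha.le
  have hs0 : 0 < √a := Real.sqrt_pos.2 ha
  rw [e0, e1, e2, f, f, A.pS, A.Sh, A.Sh']
  have : 1 / √a = √a / a := by
    rw [div_eq_div_iff hs0.ne' ha.ne']; linarith
  rw [this]; field_simp; ring

lemma QQ_eq {n : ℕ} {a b h : ℝ} {C S F p : ℝ → ℝ} (A : ACos n a b h C S) (hp : Continuous p)
    (cF : Continuous F) (pF : ∀ t, F (t + 2 * π / n) = F t) (c u w : ℝ) :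
    QQ p c C F u w = (∫ t in (-(2 * π))..0, p t * F (u + t)) -
      c * (n * (2 * (∫ t in (u - w - h)..(u - w + h), F t) - ∫ t in (0:ℝ)..(2 * π / n), F t)) := by
  rw [← sign_integral A cF pF, QQ, ← intervalIntegral.integral_const_mul,
    ← intervalIntegral.integral_sub]
  · refine intervalIntegral.integral_congr fun t _ => ?_
    ring
  · exact (hp.mul (cF.comp (continuous_const_add u))).intervalIntegrable _ _
  · refine IntervalIntegrable.const_mul ?_ c
    refine IntervalIntegrable.mul_continuousOn ?_ (cF.comp (continuous_const_add u)).continuousOn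
    exact bdd_intervalIntegrable (sg_measurable.comp
      (A.cC.comp (continuous_const_add w)).measurable) (fun t => (abs_sg _).le) _ _

lemma QQ_facts {n : ℕ} {a b h a' b' h' : ℝ} {C S C' S' p : ℝ → ℝ} (A : ACos n a b h C S)
    (A' : ACos n a' b' h' C' S') (hp : Continuous p) (c : ℝ) :
    Continuous (fun z : ℝ × ℝ => QQ p c C' S z.1 z.2) ∧
    (∀ u w, ∃ m : ℝ, HasFDerivAt (fun z : ℝ × ℝ => QQ p c C' C z.1 z.2)
      (QQ p c C' S u w • ContinuousLinearMap.fst ℝ ℝ ℝ + m • ContinuousLinearMap.snd ℝ ℝ ℝ) (u, w)) ∧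
    (∀ u w, QQ p c C' C u w = (∫ t in (-(2 * π))..0, p t * C (u + t)) -
      c * (n * (2 * (∫ t in (u - w - h')..(u - w + h'), C t) - 2 * (1 / √a - √a / b)))) := by
  have hS : ∀ u w, QQ p c C' S u w = (∫ t in (-(2 * π))..0, p t * S (u + t)) -
      c * (n * (2 * (C (u - w + h') - C (u - w - h')))) := by
    intro u w
    rw [QQ_eq A' hp A.cS A.pS, int_S A, int_S A]
    have : C (2 * π / n) = C 0 := by rw [← A.pC 0, zero_add]
    rw [this]; ring
  have hC : ∀ u w, QQ p c C' C u w = (∫ t in (-(2 * π))..0, p t * C (u + t)) -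
      c * (n * (2 * (∫ t in (u - w - h')..(u - w + h'), C t) - 2 * (1 / √a - √a / b))) := by
    intro u w
    rw [QQ_eq A' hp A.cC A.pC, int_C A]
  obtain ⟨B, hB, hBC, hBS, -, -⟩ := A.bounds
  have dG : ∀ u, HasDerivAt (fun u => ∫ t in (-(2 * π))..0, p t * C (u + t))
      (∫ t in (-(2 * π))..0, p t * S (u + t)) u := by
    intro u
    refine (intervalIntegral.hasDerivAt_integral_of_dominated_loc_of_deriv_le
      (F := fun u t => p t * C (u + t)) (F' := fun u t => p t * S (u + t))
      (bound := fun t => |p t| * B) (s := Set.univ) univ_mem ?_ ?_ ?_ ?_ ?_ ?_).2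
    · exact Eventually.of_forall fun u =>
        (hp.mul (A.cC.comp (continuous_const_add u))).aestronglyMeasurable
    · exact (hp.mul (A.cC.comp (continuous_const_add u))).intervalIntegrable _ _
    · exact (hp.mul (A.cS.comp (continuous_const_add u))).aestronglyMeasurable
    · refine Eventually.of_forall fun t _ u _ => ?_
      rw [norm_mul, Real.norm_eq_abs, Real.norm_eq_abs]
      exact mul_le_mul_of_nonneg_left (hBS _) (abs_nonneg _)
    · exact (hp.abs.mul continuous_const).intervalIntegrable _ _
    · refine Eventually.of_forall fun t _ u _ => ?_
      exact ((A.dC (u + t)).comp_add_const u t).const_mul (p t)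
  have cG : Continuous (fun u => ∫ t in (-(2 * π))..0, p t * S (u + t)) := by
    refine intervalIntegral.continuous_parametric_intervalIntegral_of_continuous' ?_ _ _
    exact (hp.comp continuous_snd).mul (A.cS.comp (continuous_fst.add continuous_snd))
  refine ⟨?_, ?_, hC⟩
  · simp only [hS]
    have := A.cC
    refine (cG.comp continuous_fst).sub ?_
    fun_prop
  · intro u w
    have dK : ∀ z, HasDerivAt (fun z => ∫ t in (0:ℝ)..z, C t) (C z) z := fun z =>
      intervalIntegral.integral_hasDerivAt_right (A.cC.intervalIntegrable _ _)
        A.cC.aestronglyMeasurable.stronglyMeasurableAtFilter A.cC.continuousAt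
    have dJ : ∀ z, HasDerivAt (fun z => ∫ t in (z - h')..(z + h'), C t) (C (z + h') - C (z - h')) z := by
      intro z
      have h1 := ((dK (z + h')).comp_add_const z h').sub ((dK (z - h')).comp_sub_const z h')
      refine h1.congr_of_eventuallyEq (Eventually.of_forall fun y => ?_)
      simp only [Pi.sub_apply]
      rw [intervalIntegral.integral_interval_sub_left] <;> exact A.cC.intervalIntegrable _ _
    refine ⟨c * (n * (2 * (C (u - w + h') - C (u - w - h')))), ?_⟩
    simp only [hC]
    have h1 : HasFDerivAt (fun z : ℝ × ℝ => ∫ t in (-(2 * π))..0, p t * C (z.1 + t)) _ (u, w) :=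
      HasDerivAt.comp_hasFDerivAt (h₂ := fun u => ∫ t in (-(2 * π))..0, p t * C (u + t))
        (f := fun z : ℝ × ℝ => z.1) (u, w) (dG u)
        (hasFDerivAt_fst (𝕜 := ℝ) (E := ℝ) (F := ℝ) (p := (u, w)))
    have h2 : HasFDerivAt (fun z : ℝ × ℝ => ∫ t in (z.1 - z.2 - h')..(z.1 - z.2 + h'), C t) _ (u, w) :=
      HasDerivAt.comp_hasFDerivAt (f := fun z : ℝ × ℝ => z.1 - z.2) (u, w) (dJ (u - w))
        ((hasFDerivAt_fst (𝕜 := ℝ) (E := ℝ) (F := ℝ) (p := (u, w))).sub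
          (hasFDerivAt_snd (𝕜 := ℝ) (E := ℝ) (F := ℝ) (p := (u, w))))
    have h3 := h1.sub ((((h2.const_mul 2).sub_const (2 * (1 / √a - √a / b))).const_mul (n:ℝ)).const_mul c)
    refine h3.congr_fderiv ?_
    rw [hS]
    ext <;> simp <;> ring


set_option maxHeartbeats 1000000 in
lemma lyap {m12 m21 μ : ℝ} (hμ : 0 < μ) (hμ1 : μ ≤ 1) (hm : |m12 + m21| ≤ 2 - 2 * μ) :
    ∃ ε > 0, ∃ η > 0, η ≤ 1 / 4 ∧ ∃ R > 0, ∀ δ > 0, ∀ q1 q2 y1 y2 q1' q2' y1' y2' : ℝ,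
      R ≤ q1 → R ≤ q2 → q1 ≤ (1 + ε) * q2 → q2 ≤ (1 + ε) * q1 → y1 ^ 2 + y2 ^ 2 ≤ δ ^ 2 →
      |q1' - q1 - 1| ≤ η → |q2' - q2 - 1| ≤ η →
      |q1 * (y1' - y1) + (y1 + m12 * y2)| ≤ η * δ →
      |q2 * (y2' - y2) + (y2 + m21 * y1)| ≤ η * δ →
      q1 + 1 / 2 ≤ q1' ∧ q2 + 1 / 2 ≤ q2' ∧ q1' ≤ (1 + ε) * q2' ∧ q2' ≤ (1 + ε) * q1' ∧
      y1' ^ 2 + y2' ^ 2 ≤ δ ^ 2 := by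
  set G := 2 + |m12| + |m21| with hG
  have hG2 : 2 ≤ G := by have := abs_nonneg m12; have := abs_nonneg m21; linarith
  have hG0 : 0 < G := by linarith
  set ε := μ / (16 * G) with hε
  have hεG : ε * G = μ / 16 := by rw [hε]; field_simp
  have hε0 : 0 < ε := by positivity
  have hεμ : ε ≤ μ / 32 := by linarith [mul_le_mul_of_nonneg_left hG2 hε0.le]
  have hε1 : ε ≤ 1 / 32 := by linarith
  refine ⟨ε, hε0, ε / 4, by positivity, by linarith, 2 + 32 * G ^ 2 / μ, by positivity, ?_⟩
  intro δ hδ q1 q2 y1 y2 q1' q2' y1' y2' hq1 hq2 h12 h21 hy e1 e2 f1 f2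
  set R := 2 + 32 * G ^ 2 / μ with hR
  have hR2 : 2 ≤ R := by have : 0 < 32 * G ^ 2 / μ := by positivity
                         linarith
  have hGR : 32 * G ^ 2 ≤ μ * R := by
    have : μ * (32 * G ^ 2 / μ) = 32 * G ^ 2 := by field_simp
    rw [hR, mul_add, this]; linarith
  rw [abs_le] at e1 e2
  refine ⟨by linarith [e1.1], by linarith [e2.1], 
    by linarith [e1.1, e1.2, e2.1, e2.2, mul_le_mul_of_nonneg_left e2.1 hε0.le,
      mul_le_mul_of_nonneg_left hε1 hε0.le],
    by linarith [e1.1, e1.2, e2.1, e2.2, mul_le_mul_of_nonneg_left e1.1 hε0.le,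
      mul_le_mul_of_nonneg_left hε1 hε0.le], ?_⟩
  set z1 := y1' - y1 with hz1
  set z2 := y2' - y2 with hz2
  have hY1 : |y1| ≤ δ := abs_le_of_sq_le_sq (by linarith [sq_nonneg y2]) hδ.le
  have hY2 : |y2| ≤ δ := abs_le_of_sq_le_sq (by linarith [sq_nonneg y1]) hδ.le
  have b1 : |y1 + m12 * y2| ≤ (1 + |m12|) * δ := by
    refine (abs_add_le _ _).trans ?_
    rw [abs_mul]; linarith [mul_le_mul_of_nonneg_left hY2 (abs_nonneg m12)]
  have b2 : |y2 + m21 * y1| ≤ (1 + |m21|) * δ := by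
    refine (abs_add_le _ _).trans ?_
    rw [abs_mul]; linarith [mul_le_mul_of_nonneg_left hY1 (abs_nonneg m21)]
  have hk : ε / 4 * δ ≤ 1 * δ := mul_le_mul_of_nonneg_right (by linarith) hδ.le
  have hGd : G * δ = 2 * δ + |m12| * δ + |m21| * δ := by rw [hG]; ring
  have g1 : |q1 * z1| ≤ G * δ := by
    have : q1 * z1 = (q1 * z1 + (y1 + m12 * y2)) - (y1 + m12 * y2) := by ring
    rw [this]; refine (abs_sub _ _).trans ?_
    linarith [mul_nonneg (abs_nonneg m21) hδ.le]
  have g2 : |q2 * z2| ≤ G * δ := by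
    have : q2 * z2 = (q2 * z2 + (y2 + m21 * y1)) - (y2 + m21 * y1) := by ring
    rw [this]; refine (abs_sub _ _).trans ?_
    linarith [mul_nonneg (abs_nonneg m12) hδ.le]
  have q1p : 0 < q1 := by linarith
  have q2p : 0 < q2 := by linarith
  -- squares
  have hsq : ∀ q z : ℝ, R ≤ q → |q * z| ≤ G * δ → q * z ^ 2 ≤ μ * δ ^ 2 / 32 := by
    intro q z hq hz
    have hqp : 0 < q := by linarith
    have h1 : (q * z) ^ 2 ≤ (G * δ) ^ 2 := sq_le_sq' (abs_le.1 hz).1 (abs_le.1 hz).2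
    have h2 : (G * δ) ^ 2 ≤ q * (μ * δ ^ 2 / 32) := by
      have : G ^ 2 * δ ^ 2 ≤ (μ * q / 32) * δ ^ 2 := by
        apply mul_le_mul_of_nonneg_right _ (sq_nonneg δ)
        linarith [mul_le_mul_of_nonneg_left hq hμ.le]
      linarith
    have h3 : q * (q * z ^ 2) ≤ q * (μ * δ ^ 2 / 32) := by linarith
    exact le_of_mul_le_mul_left h3 hqp
  have s1 := hsq q1 z1 hq1 g1
  have s2 := hsq q2 z2 hq2 g2
  have s2' : q1 * z2 ^ 2 ≤ μ * δ ^ 2 / 16 := by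
    have : q1 * z2 ^ 2 ≤ (1 + ε) * q2 * z2 ^ 2 := mul_le_mul_of_nonneg_right h12 (sq_nonneg _)
    have h0 : 0 ≤ q2 * z2 ^ 2 := by positivity
    linarith [mul_le_mul_of_nonneg_right hε1 h0]
  -- cross terms
  have c0 : |q1 - q2| ≤ 2 * ε * q2 := by
    rw [abs_le]; constructor
    · have := mul_le_mul_of_nonneg_left h12 hε0.le
      have : ε * ((1 + ε) * q2) ≤ 2 * ε * q2 := by
        linarith [mul_pos hε0 q2p, mul_le_mul_of_nonneg_right hε1 (mul_pos hε0 q2p).le]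
      linarith
    · linarith [mul_pos hε0 q2p]
  have c1 : |(q1 - q2) * z2| ≤ 2 * (μ / 16) * δ := by
    rw [abs_mul]
    have h1 := mul_le_mul_of_nonneg_right c0 (abs_nonneg z2)
    have h2 : q2 * |z2| ≤ G * δ := by rw [abs_mul, abs_of_pos q2p] at g2; exact g2
    have h3 := mul_le_mul_of_nonneg_left h2 (by positivity : 0 ≤ 2 * ε)
    have h4 : 2 * ε * (G * δ) = 2 * (μ / 16) * δ := by rw [← hεG]; ring
    rw [h4] at h3
    linarith
  have prod : ∀ y r k : ℝ, 0 ≤ k → |y| ≤ δ → |r| ≤ k * δ → y * r ≤ k * δ ^ 2 := by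
    intro y r k hk hy hr
    refine (le_abs_self _).trans ?_
    rw [abs_mul]
    have := mul_le_mul hy hr (abs_nonneg _) hδ.le
    linarith
  have p1 := prod y1 _ _ (by positivity) hY1 f1
  have p2 := prod y2 _ _ (by positivity) hY2 f2
  have p3 := prod y2 _ _ (by positivity) hY2 c1
  have hcross : -((m12 + m21) * (y1 * y2)) ≤ (1 - μ) * (y1 ^ 2 + y2 ^ 2) := by
    refine (neg_le_abs _).trans ?_
    rw [abs_mul]
    have h1 : |y1 * y2| ≤ (y1 ^ 2 + y2 ^ 2) / 2 := by
      rw [abs_le]; constructor <;> linarith [sq_nonneg (y1 + y2), sq_nonneg (y1 - y2)]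
    have := mul_le_mul hm h1 (abs_nonneg _) (by linarith)
    linarith
  by_contra hcon
  push Not at hcon
  have key : q1 * (y1' ^ 2 + y2' ^ 2 - (y1 ^ 2 + y2 ^ 2)) ≤
      μ * δ ^ 2 - 2 * μ * (y1 ^ 2 + y2 ^ 2) := by
    have e : q1 * (y1' ^ 2 + y2' ^ 2 - (y1 ^ 2 + y2 ^ 2)) =
      2 * (y1 * (q1 * z1 + (y1 + m12 * y2))) + 2 * (y2 * (q2 * z2 + (y2 + m21 * y1)))
      + 2 * (y2 * ((q1 - q2) * z2)) + q1 * z1 ^ 2 + q1 * z2 ^ 2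
      - 2 * (y1 ^ 2 + y2 ^ 2) + 2 * (-((m12 + m21) * (y1 * y2))) := by
      rw [hz1, hz2]; ring
    rw [e]
    have : ε / 4 * δ ^ 2 ≤ μ / 128 * δ ^ 2 := mul_le_mul_of_nonneg_right (by linarith) (sq_nonneg _)
    have hp : 0 < μ * δ ^ 2 := by positivity
    linarith
  have k2 : q1 * (δ ^ 2 - (y1 ^ 2 + y2 ^ 2)) ≤ q1 * (y1' ^ 2 + y2' ^ 2 - (y1 ^ 2 + y2 ^ 2)) :=
    mul_le_mul_of_nonneg_left (by linarith) q1p.le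
  have k3 : (2 * μ) * (δ ^ 2 - (y1 ^ 2 + y2 ^ 2)) ≤ q1 * (δ ^ 2 - (y1 ^ 2 + y2 ^ 2)) :=
    mul_le_mul_of_nonneg_right (by linarith) (by linarith)
  have hp : 0 < μ * δ ^ 2 := by positivity
  linarith

/-- local expansion of the averaged field at a zero -/
lemma local_exp {n : ℕ} {a b h a' b' h' : ℝ} {C S C' S' p : ℝ → ℝ} (A : ACos n a b h C S)
    (A' : ACos n a' b' h' C' S') (hp : Continuous p) (c u w : ℝ) {j m : ℝ} (hj : 0 < j)
    (hjS : QQ p c C' S u w = -j) (hz : QQ p c C' C u w = 0)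
    (hm : HasFDerivAt (fun z : ℝ × ℝ => QQ p c C' C z.1 z.2)
      (QQ p c C' S u w • ContinuousLinearMap.fst ℝ ℝ ℝ + (-j * m) • ContinuousLinearMap.snd ℝ ℝ ℝ)
      (u, w)) {η : ℝ} (hη : 0 < η) :
    ∃ δ₀ > 0, ∀ δ, δ ≤ δ₀ → ∀ y z : ℝ, |y| ≤ δ → |z| ≤ δ →
      |QQ p c C' S (u + y) (w + z) + j| ≤ η * j ∧
      |QQ p c C' C (u + y) (w + z) + j * (y + m * z)| ≤ η * δ * j := by
  have hc := (QQ_facts A A' hp c).1.continuousAt (x := (u, w))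
  rw [Metric.continuousAt_iff] at hc
  obtain ⟨d1, hd1, h1⟩ := hc (η * j) (by positivity)
  have hl := hm.isLittleO
  rw [Asymptotics.isLittleO_iff] at hl
  obtain ⟨d2, hd2, h2⟩ := Metric.eventually_nhds_iff.1 (hl (c := η * j) (by positivity))
  refine ⟨min d1 d2 / 2, by positivity, fun δ hδ y z hy hz' => ?_⟩
  have hlt : min d1 d2 / 2 < min d1 d2 := half_lt_self (by positivity)
  have hd : dist ((u + y, w + z) : ℝ × ℝ) (u, w) ≤ δ := by
    rw [Prod.dist_eq, Real.dist_eq, Real.dist_eq]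
    simp only [add_sub_cancel_left]
    exact max_le hy hz'
  constructor
  · have := h1 (x := (u + y, w + z)) (lt_of_le_of_lt hd (by linarith [min_le_left d1 d2]))
    rw [Real.dist_eq] at this
    simp only [hjS] at this
    rw [sub_neg_eq_add] at this
    exact this.le
  · have := h2 (y := (u + y, w + z)) (lt_of_le_of_lt hd (by linarith [min_le_right d1 d2]))
    rw [← dist_eq_norm (u + y, w + z)] at this
    simp only [hz, hjS] at this
    simp at this
    have e : QQ p c C' C (u + y) (w + z) + j * (y + m * z) =
      QQ p c C' C (u + y) (w + z) - (-(j * y) + -(j * m * z)) := by ring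
    rw [e]
    refine this.trans ?_
    have := mul_le_mul_of_nonneg_left hd (by positivity : 0 ≤ η * j)
    linarith


/-- All the data about one component of the system. -/
structure Comp (n : ℕ) (a b h : ℝ) (C S : ℝ → ℝ) (a' b' h' : ℝ) (C' S' : ℝ → ℝ) (p φ : ℝ → ℝ)
    (c u w j m : ℝ) : Prop where
  A : ACos n a b h C S
  A' : ACos n a' b' h' C' S'
  hp : Continuous p
  pp : ∀ t, p (t + 2 * π) = p t
  cφ : Continuous φ
  bφ : ∃ M, ∀ x, |φ x| ≤ M
  htop : Tendsto φ atTop (nhds c)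
  hbot : Tendsto φ atBot (nhds (-c))
  hj : 0 < j
  hjS : QQ p c C' S u w = -j
  hz : QQ p c C' C u w = 0
  hm : HasFDerivAt (fun z : ℝ × ℝ => QQ p c C' C z.1 z.2)
      (QQ p c C' S u w • ContinuousLinearMap.fst ℝ ℝ ℝ + (-j * m) • ContinuousLinearMap.snd ℝ ℝ ℝ)
      (u, w)

lemma comp_step {n : ℕ} {a b h : ℝ} {C S : ℝ → ℝ} {a' b' h' : ℝ} {C' S' : ℝ → ℝ} {p φ : ℝ → ℝ}
    {c u w j m : ℝ} (K : Comp n a b h C S a' b' h' C' S' p φ c u w j m) {η M : ℝ} (hη : 0 < η)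
    (hM : 0 < M) (hφM : ∀ x, |φ x| ≤ M) :
    ∃ δ₀ > 0, ∀ δ > 0, δ ≤ δ₀ → ∃ R > 0, ∀ f f' ρ τ ρ' τ' : ℝ → ℝ,
      ContinuousOn f (Set.Icc (-(2 * π)) 0) →
      (∀ t ∈ Set.Icc (-(2 * π)) 0, |f t| ≤ M) → (∀ t ∈ Set.Icc (-(2 * π)) 0, |f' t| ≤ M) →
      (∀ t ∈ Set.Icc (-(2 * π)) 0, f t = p t - φ (ρ' t * C' (τ' t))) →
      (∀ t ∈ Set.Icc (-(2 * π)) 0, 0 < ρ t ∧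
        HasDerivAt ρ (f t * S (τ t) / a) t ∧ HasDerivAt τ (1 - f t * C (τ t) / (a * ρ t)) t) →
      (∀ t ∈ Set.Icc (-(2 * π)) 0, 0 < ρ' t ∧
        HasDerivAt ρ' (f' t * S' (τ' t) / a') t ∧
        HasDerivAt τ' (1 - f' t * C' (τ' t) / (a' * ρ' t)) t) →
      R ≤ ρ 0 → R ≤ ρ' 0 → ∀ q y z, ρ 0 = j * q / a → τ 0 = u + y → τ' 0 = w + z → |y| ≤ δ → |z| ≤ δ →
      (∀ t ∈ Set.Icc (-(2 * π)) 0, ρ 0 / 2 ≤ ρ t) ∧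
      |a * ρ (-(2 * π)) / j - q - 1| ≤ η ∧
      |q * ((τ (-(2 * π)) + 2 * π - u) - y) + (y + m * z)| ≤ η * δ := by
  have hj := K.hj
  have ha := K.A.ha
  obtain ⟨δ₀, hδ₀, H⟩ := local_exp K.A K.A' K.hp c u w hj K.hjS K.hz K.hm (half_pos hη)
  refine ⟨δ₀, hδ₀, fun δ hδ hδδ => ?_⟩
  obtain ⟨R, hR, HR⟩ := avg K.A K.A' hM K.hp hφM K.htop K.hbot
    (ε := min (η / 2 * j) (η / 2 * δ * j)) (by positivity)
  refine ⟨R, hR, ?_⟩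
  intro f f' ρ τ ρ' τ' cf hf hf' hff hd hd' h0 h0' q y z hq hy hz hyδ hzδ
  obtain ⟨g1, g2, g3⟩ := HR f f' ρ τ ρ' τ' cf hf hf' hff hd hd' h0 h0'
  obtain ⟨l1, l2⟩ := H δ hδδ y z hyδ hzδ
  rw [hy, hz] at g2 g3
  have g2 := g2.trans (min_le_left _ _)
  have g3 := g3.trans (min_le_right _ _)
  refine ⟨g1, ?_, ?_⟩
  · have e : a * ρ (-(2 * π)) / j - q - 1 = ((a * (ρ (-(2 * π)) - ρ 0) + QQ p c C' S (u + y) (w + z)) -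
      (QQ p c C' S (u + y) (w + z) + j)) / j := by
      rw [hq]; field_simp; ring
    rw [e, abs_div, abs_of_pos hj, div_le_iff₀ hj]
    refine (abs_sub _ _).trans ?_
    linarith
  · have e : q * ((τ (-(2 * π)) + 2 * π - u) - y) + (y + m * z) =
      ((a * ρ 0 * (τ (-(2 * π)) + 2 * π - (u + y)) - QQ p c C' C (u + y) (w + z)) +
      (QQ p c C' C (u + y) (w + z) + j * (y + m * z))) / j := by
      rw [hq]; field_simp; ring
    rw [e, abs_div, abs_of_pos hj, div_le_iff₀ hj]
    refine (abs_add_le _ _).trans ?_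
    linarith

/-- the invariant region -/
def Reg (ε δ R q1 q2 y1 y2 : ℝ) : Prop :=
  R ≤ q1 ∧ R ≤ q2 ∧ q1 ≤ (1 + ε) * q2 ∧ q2 ≤ (1 + ε) * q1 ∧ y1 ^ 2 + y2 ^ 2 ≤ δ ^ 2

/-- solutions -/
def Sol (a b : ℝ) (p φ x v x' : ℝ → ℝ) : Prop :=
  ∀ t ≤ 0, HasDerivAt x (v t) t ∧ HasDerivAt v (p t - φ (x' t) - gg a b (x t)) t

lemma Sol.shift {a b : ℝ} {p φ x v x' : ℝ → ℝ} (h : Sol a b p φ x v x')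
    (pp : ∀ t, p (t + 2 * π) = p t) :
    Sol a b p φ (fun t => x (t - 2 * π)) (fun t => v (t - 2 * π)) (fun t => x' (t - 2 * π)) := by
  intro t ht
  have hπ := Real.pi_pos
  have := h (t - 2 * π) (by linarith)
  refine ⟨this.1.comp_sub_const t (2 * π), ?_⟩
  have e : p t = p (t - 2 * π) := by rw [← pp (t - 2 * π)]; congr 1; ring
  rw [e]
  exact this.2.comp_sub_const t (2 * π)

lemma HH_le {a b : ℝ} (ha : 0 < a) (hb : 0 < b) (x v : ℝ) :
    HH a b x v ≤ (1 + a + b) * (x ^ 2 + v ^ 2) := by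
  have h1 : 0 ≤ x ^ 2 := sq_nonneg x
  have h2 : 0 ≤ v ^ 2 := sq_nonneg v
  have := mul_nonneg ha.le h2
  have := mul_nonneg hb.le h2
  have := mul_nonneg ha.le h1
  have := mul_nonneg hb.le h1
  rcases le_total 0 x with h | h
  · simp only [HH, max_eq_left h, max_eq_right (neg_nonpos.2 h)]; linarith
  · simp only [HH, max_eq_right h, max_eq_left (neg_nonneg.2 h)]; linarith

lemma step {n : ℕ} {a₁ b₁ h₁ : ℝ} {C₁ S₁ : ℝ → ℝ} {a₂ b₂ h₂ : ℝ} {C₂ S₂ : ℝ → ℝ} {p₁ φ₁ p₂ φ₂ : ℝ → ℝ}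
    {c₁ c₂ u₁ u₂ j₁ j₂ m12 m21 : ℝ} (K₁ : Comp n a₁ b₁ h₁ C₁ S₁ a₂ b₂ h₂ C₂ S₂ p₁ φ₁ c₁ u₁ u₂ j₁ m12)
    (K₂ : Comp n a₂ b₂ h₂ C₂ S₂ a₁ b₁ h₁ C₁ S₁ p₂ φ₂ c₂ u₂ u₁ j₂ m21) (hm : |m12 + m21| < 2) :
    ∃ ε > 0, ∃ δ > 0, ∃ R > 0, ∃ κ > 0, ∀ x₁ x₂ v₁ v₂ : ℝ → ℝ, Sol a₁ b₁ p₁ φ₁ x₁ v₁ x₂ →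
      Sol a₂ b₂ p₂ φ₂ x₂ v₂ x₁ → ∀ q1 q2 y1 y2, Reg ε δ R q1 q2 y1 y2 →
      x₁ 0 = j₁ * q1 / a₁ * C₁ (u₁ + y1) → v₁ 0 = j₁ * q1 / a₁ * S₁ (u₁ + y1) →
      x₂ 0 = j₂ * q2 / a₂ * C₂ (u₂ + y2) → v₂ 0 = j₂ * q2 / a₂ * S₂ (u₂ + y2) →
      (∀ t ∈ Set.Icc (-(2 * π)) 0, κ * q1 ^ 2 ≤ x₁ t ^ 2 + v₁ t ^ 2 ∧
        κ * q2 ^ 2 ≤ x₂ t ^ 2 + v₂ t ^ 2) ∧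
      ∃ q1' q2' y1' y2', Reg ε δ R q1' q2' y1' y2' ∧ q1 + 1 / 2 ≤ q1' ∧ q2 + 1 / 2 ≤ q2' ∧
      x₁ (-(2 * π)) = j₁ * q1' / a₁ * C₁ (u₁ + y1') ∧
      v₁ (-(2 * π)) = j₁ * q1' / a₁ * S₁ (u₁ + y1') ∧
      x₂ (-(2 * π)) = j₂ * q2' / a₂ * C₂ (u₂ + y2') ∧
      v₂ (-(2 * π)) = j₂ * q2' / a₂ * S₂ (u₂ + y2') := by
  have hπ := Real.pi_pos
  have ha₁ := K₁.A.ha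
  have ha₂ := K₂.A.ha
  have hb₁ := K₁.A.hb
  have hb₂ := K₂.A.hb
  have hj₁ := K₁.hj
  have hj₂ := K₂.hj
  -- bound
  have pb : ∀ p : ℝ → ℝ, Continuous p → ∃ P, ∀ t ∈ Set.Icc (-(2 * π)) 0, |p t| ≤ P := by
    intro p hp
    obtain ⟨P, hP⟩ := isCompact_Icc.exists_bound_of_continuousOn
      (s := Set.Icc (-(2 * π)) (0:ℝ)) hp.continuousOn
    exact ⟨P, hP⟩
  obtain ⟨P₁, hP₁⟩ := pb p₁ K₁.hp
  obtain ⟨P₂, hP₂⟩ := pb p₂ K₂.hp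
  obtain ⟨F₁, hF₁⟩ := K₁.bφ
  obtain ⟨F₂, hF₂⟩ := K₂.bφ
  set M := |P₁| + |P₂| + |F₁| + |F₂| + 1 with hMdef
  have hM : 0 < M := by positivity
  have hM1 : ∀ x, |φ₁ x| ≤ M := fun x => by
    have := hF₁ x
    have := le_abs_self F₁
    have := abs_nonneg P₁; have := abs_nonneg P₂; have := abs_nonneg F₂; linarith
  have hM2 : ∀ x, |φ₂ x| ≤ M := fun x => by
    have := hF₂ x
    have := le_abs_self F₂
    have := abs_nonneg P₁; have := abs_nonneg P₂; have := abs_nonneg F₁; linarith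
  -- Lyapunov constants
  set μ := 1 - |m12 + m21| / 2 with hμdef
  have hμ : 0 < μ := by linarith
  have hμ1 : μ ≤ 1 := by have := abs_nonneg (m12 + m21); linarith
  obtain ⟨ε, hε, η, hη, hη4, R0, hR0, LY⟩ := lyap hμ hμ1 (by linarith : |m12 + m21| ≤ 2 - 2 * μ)
  obtain ⟨d1, hd1, H1⟩ := comp_step K₁ hη hM hM1
  obtain ⟨d2, hd2, H2⟩ := comp_step K₂ hη hM hM2
  set δ := min d1 d2 with hδdef
  have hδ : 0 < δ := lt_min hd1 hd2
  obtain ⟨R1, hR1, H1⟩ := H1 δ hδ (min_le_left _ _)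
  obtain ⟨R2, hR2, H2⟩ := H2 δ hδ (min_le_right _ _)
  -- choose R
  have hs₁ : 0 < √a₁ := Real.sqrt_pos.2 ha₁
  have hs₂ : 0 < √a₂ := Real.sqrt_pos.2 ha₂
  set W₁ := R1 + R2 + (2 * π * M + 2) / √a₁ with hW₁
  set W₂ := R1 + R2 + (2 * π * M + 2) / √a₂ with hW₂
  have hW₁p : 0 < W₁ := by positivity
  have hW₂p : 0 < W₂ := by positivity
  refine ⟨ε, hε, δ, hδ, R0 + W₁ * a₁ / j₁ + W₂ * a₂ / j₂, by positivity,
    min (a₁ * (j₁ / a₁ / 2) ^ 2 / (1 + a₁ + b₁)) (a₂ * (j₂ / a₂ / 2) ^ 2 / (1 + a₂ + b₂)),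
    by positivity, ?_⟩
  intro x₁ x₂ v₁ v₂ so1 so2 q1 q2 y1 y2 hreg hx1 hv1 hx2 hv2
  set R := R0 + W₁ * a₁ / j₁ + W₂ * a₂ / j₂ with hRdef
  obtain ⟨r1, r2, r3, r4, r5⟩ := hreg
  have hw1 : 0 < W₁ * a₁ / j₁ := by positivity
  have hw2 : 0 < W₂ * a₂ / j₂ := by positivity
  have big₁ : W₁ ≤ j₁ * q1 / a₁ := by
    rw [le_div_iff₀ ha₁]
    have : W₁ * a₁ / j₁ ≤ q1 := by linarith
    rw [div_le_iff₀ hj₁] at this; linarith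
  have big₂ : W₂ ≤ j₂ * q2 / a₂ := by
    rw [le_div_iff₀ ha₂]
    have : W₂ * a₂ / j₂ ≤ q2 := by linarith
    rw [div_le_iff₀ hj₂] at this; linarith
  have hz1 : 0 < (2 * π * M + 2) / √a₁ := by positivity
  have hz2 : 0 < (2 * π * M + 2) / √a₂ := by positivity
  have cont : ∀ x : ℝ → ℝ, (∀ t ≤ 0, ∃ d, HasDerivAt x d t) →
      ContinuousOn x (Set.Icc (-(2 * π)) 0) := by
    intro x hx t ht
    obtain ⟨d, hd⟩ := hx t ht.2
    exact hd.continuousAt.continuousWithinAt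
  have cx₁ := cont x₁ fun t ht => ⟨_, (so1 t ht).1⟩
  have cx₂ := cont x₂ fun t ht => ⟨_, (so2 t ht).1⟩
  set f₁ : ℝ → ℝ := fun t => p₁ t - φ₁ (x₂ t) with hf₁
  set f₂ : ℝ → ℝ := fun t => p₂ t - φ₂ (x₁ t) with hf₂
  have cf₁ : ContinuousOn f₁ (Set.Icc (-(2 * π)) 0) :=
    K₁.hp.continuousOn.sub (K₁.cφ.comp_continuousOn cx₂)
  have cf₂ : ContinuousOn f₂ (Set.Icc (-(2 * π)) 0) :=
    K₂.hp.continuousOn.sub (K₂.cφ.comp_continuousOn cx₁)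
  have fM₁ : ∀ t ∈ Set.Icc (-(2 * π)) 0, |f₁ t| ≤ M := by
    intro t ht
    refine (abs_sub _ _).trans ?_
    have := hP₁ t ht; have := hF₁ (x₂ t)
    have := le_abs_self F₁; have := le_abs_self P₁
    have := abs_nonneg P₂; have := abs_nonneg F₂; linarith
  have fM₂ : ∀ t ∈ Set.Icc (-(2 * π)) 0, |f₂ t| ≤ M := by
    intro t ht
    refine (abs_sub _ _).trans ?_
    have := hP₂ t ht; have := hF₂ (x₁ t)
    have := le_abs_self F₂; have := le_abs_self P₂
    have := abs_nonneg P₁; have := abs_nonneg F₁; linarith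
  have pre : ∀ s W r : ℝ, 0 < s → (2 * π * M + 2) / s ≤ W → W ≤ r → 2 * π * M + 1 < s * r := by
    intro s W r hs h1 h2
    have := h1.trans h2
    rw [div_le_iff₀ hs] at this
    linarith
  obtain ⟨ρ₁, τ₁, i1, k1, P1⟩ := polar K₁.A hM cf₁ fM₁ (fun t ht => (so1 t ht.2).1)
    (fun t ht => (so1 t ht.2).2) (pre _ _ _ hs₁ (by rw [hW₁]; linarith) big₁) hx1 hv1
  obtain ⟨ρ₂, τ₂, i2, k2, P2⟩ := polar K₂.A hM cf₂ fM₂ (fun t ht => (so2 t ht.2).1)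
    (fun t ht => (so2 t ht.2).2) (pre _ _ _ hs₂ (by rw [hW₂]; linarith) big₂) hx2 hv2
  have hY1 : |y1| ≤ δ := abs_le_of_sq_le_sq (by linarith [sq_nonneg y2]) hδ.le
  have hY2 : |y2| ≤ δ := abs_le_of_sq_le_sq (by linarith [sq_nonneg y1]) hδ.le
  obtain ⟨o1, o2, o3⟩ := H1 f₁ f₂ ρ₁ τ₁ ρ₂ τ₂ cf₁ fM₁ fM₂
    (fun t ht => by simp only [hf₁]; rw [(P2 t ht).1]) (fun t ht => (P1 t ht).2.2)
    (fun t ht => (P2 t ht).2.2) (by rw [i1]; linarith) (by rw [i2]; linarith) q1 y1 y2 i1 k1 k2 hY1 hY2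
  obtain ⟨o4, o5, o6⟩ := H2 f₂ f₁ ρ₂ τ₂ ρ₁ τ₁ cf₂ fM₂ fM₁
    (fun t ht => by simp only [hf₂]; rw [(P1 t ht).1]) (fun t ht => (P2 t ht).2.2)
    (fun t ht => (P1 t ht).2.2) (by rw [i2]; linarith) (by rw [i1]; linarith) q2 y2 y1 i2 k2 k1 hY2 hY1
  obtain ⟨l1, l2, l3, l4, l5⟩ := LY δ hδ q1 q2 y1 y2 _ _ _ _ (by linarith) (by linarith) r3 r4 r5 o2 o5
    o3 o6
  have hI : -(2 * π) ∈ Set.Icc (-(2 * π)) (0:ℝ) := ⟨le_rfl, by linarith⟩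
  have low : ∀ (a b j q x v ρ c s : ℝ), 0 < a → 0 < b → 0 < j → 0 < q → 0 < ρ → HH a b c s = a →
      j * q / a / 2 ≤ ρ → x = ρ * c → v = ρ * s →
      a * (j / a / 2) ^ 2 / (1 + a + b) * q ^ 2 ≤ x ^ 2 + v ^ 2 := by
    intro a b j q x v ρ c s ha hb hj hq hρ hen hle hx hv
    have h1 := HH_le ha hb x v
    rw [hx, hv, HH_hom hρ.le, hen, ← hx, ← hv] at h1
    have h2 : (j * q / a / 2) ^ 2 ≤ ρ ^ 2 := by
      have : 0 < j * q / a / 2 := by positivity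
      exact pow_le_pow_left₀ this.le hle 2
    rw [div_mul_eq_mul_div, div_le_iff₀ (by positivity)]
    have h3 := mul_le_mul_of_nonneg_right h2 ha.le
    have e : a * (j / a / 2) ^ 2 * q ^ 2 = (j * q / a / 2) ^ 2 * a := by ring
    rw [e]; linarith
  refine ⟨fun t ht => ⟨?_, ?_⟩, _, _, _, _, ⟨by linarith, by linarith, l3, l4, l5⟩, l1, l2, ?_, ?_, ?_, ?_⟩
  · refine (mul_le_mul_of_nonneg_right (min_le_left _ _) (sq_nonneg _)).trans ?_
    exact low a₁ b₁ j₁ q1 _ _ (ρ₁ t) (C₁ (τ₁ t)) (S₁ (τ₁ t)) ha₁ hb₁ hj₁ (by linarith) (P1 t ht).2.2.1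
      (K₁.A.en _) (by rw [← i1]; exact o1 t ht) (P1 t ht).1 (P1 t ht).2.1
  · refine (mul_le_mul_of_nonneg_right (min_le_right _ _) (sq_nonneg _)).trans ?_
    exact low a₂ b₂ j₂ q2 _ _ (ρ₂ t) (C₂ (τ₂ t)) (S₂ (τ₂ t)) ha₂ hb₂ hj₂ (by linarith) (P2 t ht).2.2.1
      (K₂.A.en _) (by rw [← i2]; exact o4 t ht) (P2 t ht).1 (P2 t ht).2.1
  · rw [(P1 _ hI).1, add_sub_cancel, K₁.A.per2 K₁.A.pC]; field_simp
  · rw [(P1 _ hI).2.1, add_sub_cancel, K₁.A.per2 K₁.A.pS]; field_simp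
  · rw [(P2 _ hI).1, add_sub_cancel, K₂.A.per2 K₂.A.pC]; field_simp
  · rw [(P2 _ hI).2.1, add_sub_cancel, K₂.A.per2 K₂.A.pS]; field_simp


lemma tendsto_of_growth {F : ℝ → ℝ} {κ r : ℝ} (hκ : 0 < κ) (hr : 0 ≤ r)
    (h : ∀ k : ℕ, ∀ t ∈ Set.Icc (-(2 * π)) 0, κ * (r + k / 2) ^ 2 ≤ F (t - k * (2 * π))) :
    Tendsto F atBot atTop := by
  have hπ := Real.pi_pos
  rw [tendsto_atTop]
  intro B
  obtain ⟨N, hN⟩ := exists_nat_ge (2 * (1 + |B| / κ))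
  filter_upwards [eventually_le_atBot (-(2 * π * N))] with t ht
  have h2π : 0 < 2 * π := by linarith
  have ht0 : t ≤ 0 := ht.trans (by have : (0:ℝ) ≤ 2 * π * N := by positivity
                                   linarith)
  set k := ⌊-t / (2 * π)⌋₊ with hk
  have hnn : 0 ≤ -t / (2 * π) := div_nonneg (by linarith) h2π.le
  have k1 : (k : ℝ) ≤ -t / (2 * π) := Nat.floor_le hnn
  have k2 : -t / (2 * π) < k + 1 := Nat.lt_floor_add_one _
  rw [le_div_iff₀ h2π] at k1
  rw [div_lt_iff₀ h2π] at k2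
  have hNk : N ≤ k := by
    rw [hk]; apply Nat.le_floor
    rw [le_div_iff₀ h2π]; linarith
  have hNk' : (N : ℝ) ≤ k := by exact_mod_cast hNk
  have := h k (t + k * (2 * π)) ⟨by linarith, by linarith⟩
  rw [add_sub_cancel_right] at this
  refine le_trans ?_ this
  have hB : 0 ≤ |B| / κ := by positivity
  have h3 : 1 + |B| / κ ≤ r + k / 2 := by linarith
  have h4 : |B| / κ ≤ (r + k / 2) ^ 2 := by nlinarith
  rw [div_le_iff₀ hκ] at h4
  linarith [le_abs_self B]

lemma escape {n : ℕ} {a₁ b₁ h₁ : ℝ} {C₁ S₁ : ℝ → ℝ} {a₂ b₂ h₂ : ℝ} {C₂ S₂ : ℝ → ℝ} {p₁ φ₁ p₂ φ₂ : ℝ → ℝ}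
    {c₁ c₂ u₁ u₂ j₁ j₂ m12 m21 : ℝ} (K₁ : Comp n a₁ b₁ h₁ C₁ S₁ a₂ b₂ h₂ C₂ S₂ p₁ φ₁ c₁ u₁ u₂ j₁ m12)
    (K₂ : Comp n a₂ b₂ h₂ C₂ S₂ a₁ b₁ h₁ C₁ S₁ p₂ φ₂ c₂ u₂ u₁ j₂ m21) (hm : |m12 + m21| < 2) :
    ∃ ε > 0, ∃ δ > 0, ∃ R > 0, ∀ x₁ x₂ v₁ v₂ : ℝ → ℝ, Sol a₁ b₁ p₁ φ₁ x₁ v₁ x₂ →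
      Sol a₂ b₂ p₂ φ₂ x₂ v₂ x₁ → ∀ q1 q2 y1 y2, Reg ε δ R q1 q2 y1 y2 →
      x₁ 0 = j₁ * q1 / a₁ * C₁ (u₁ + y1) → v₁ 0 = j₁ * q1 / a₁ * S₁ (u₁ + y1) →
      x₂ 0 = j₂ * q2 / a₂ * C₂ (u₂ + y2) → v₂ 0 = j₂ * q2 / a₂ * S₂ (u₂ + y2) →
      Tendsto (fun t => x₁ t ^ 2 + v₁ t ^ 2) atBot atTop ∧
      Tendsto (fun t => x₂ t ^ 2 + v₂ t ^ 2) atBot atTop := by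
  obtain ⟨ε, hε, δ, hδ, R, hR, κ, hκ, H⟩ := step K₁ K₂ hm
  refine ⟨ε, hε, δ, hδ, R, hR, ?_⟩
  have key : ∀ k : ℕ, ∀ r : ℝ, 0 ≤ r → ∀ x₁ x₂ v₁ v₂ : ℝ → ℝ, Sol a₁ b₁ p₁ φ₁ x₁ v₁ x₂ →
      Sol a₂ b₂ p₂ φ₂ x₂ v₂ x₁ → ∀ q1 q2 y1 y2, Reg ε δ R q1 q2 y1 y2 → r ≤ q1 → r ≤ q2 →
      x₁ 0 = j₁ * q1 / a₁ * C₁ (u₁ + y1) → v₁ 0 = j₁ * q1 / a₁ * S₁ (u₁ + y1) →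
      x₂ 0 = j₂ * q2 / a₂ * C₂ (u₂ + y2) → v₂ 0 = j₂ * q2 / a₂ * S₂ (u₂ + y2) →
      ∀ t ∈ Set.Icc (-(2 * π)) 0,
        κ * (r + k / 2) ^ 2 ≤ x₁ (t - k * (2 * π)) ^ 2 + v₁ (t - k * (2 * π)) ^ 2 ∧
        κ * (r + k / 2) ^ 2 ≤ x₂ (t - k * (2 * π)) ^ 2 + v₂ (t - k * (2 * π)) ^ 2 := by
    intro k
    induction k with
    | zero =>
      intro r hr x₁ x₂ v₁ v₂ so1 so2 q1 q2 y1 y2 reg r1 r2 e1 e2 e3 e4 t ht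
      have := (H x₁ x₂ v₁ v₂ so1 so2 q1 q2 y1 y2 reg e1 e2 e3 e4).1 t ht
      simp only [Nat.cast_zero, zero_div, add_zero, zero_mul, sub_zero]
      exact ⟨le_trans (mul_le_mul_of_nonneg_left (pow_le_pow_left₀ hr r1 2) hκ.le) this.1,
        le_trans (mul_le_mul_of_nonneg_left (pow_le_pow_left₀ hr r2 2) hκ.le) this.2⟩
    | succ k ih =>
      intro r hr x₁ x₂ v₁ v₂ so1 so2 q1 q2 y1 y2 reg r1 r2 e1 e2 e3 e4 t ht
      obtain ⟨-, q1', q2', y1', y2', reg', s1, s2, f1, f2, f3, f4⟩ :=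
        H x₁ x₂ v₁ v₂ so1 so2 q1 q2 y1 y2 reg e1 e2 e3 e4
      have := ih (r + 1 / 2) (by linarith) _ _ _ _ (so1.shift K₁.pp) (so2.shift K₂.pp) q1' q2' y1' y2'
        reg' (by linarith) (by linarith) (by simpa using f1) (by simpa using f2) (by simpa using f3)
        (by simpa using f4) t ht
      have z1 : t - k * (2 * π) - 2 * π = t - ((k + 1 : ℕ) : ℝ) * (2 * π) := by push_cast; ring
      have z2 : r + 1 / 2 + (k : ℝ) / 2 = r + ((k + 1 : ℕ) : ℝ) / 2 := by push_cast; ring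
      rw [z1, z2] at this
      exact this
  intro x₁ x₂ v₁ v₂ so1 so2 q1 q2 y1 y2 reg e1 e2 e3 e4
  have := fun k => key k R hR.le x₁ x₂ v₁ v₂ so1 so2 q1 q2 y1 y2 reg reg.1 reg.2.1 e1 e2 e3 e4
  exact ⟨tendsto_of_growth (F := fun t => x₁ t ^ 2 + v₁ t ^ 2) hκ hR.le fun k t ht => (this k t ht).1,
    tendsto_of_growth (F := fun t => x₂ t ^ 2 + v₂ t ^ 2) hκ hR.le fun k t ht => (this k t ht).2⟩

lemma polar_open {n : ℕ} {a b h : ℝ} {C S : ℝ → ℝ} (A : ACos n a b h C S) (u : ℝ) {r ζ : ℝ}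
    (hr : 0 < r) (hζ : 0 < ζ) :
    ∃ ε > 0, ∀ X V : ℝ, |X - r * C u| < ε → |V - r * S u| < ε →
      ∃ s y : ℝ, |s - 1| ≤ ζ ∧ |y| ≤ ζ ∧ X = r * s * C (u + y) ∧ V = r * s * S (u + y) := by
  have ha := A.ha
  have sC : HasStrictDerivAt C (S u) u :=
    hasStrictDerivAt_of_hasDerivAt_of_continuousAt (Eventually.of_forall A.dC) A.cS.continuousAt
  have sS : HasStrictDerivAt S (-gg a b (C u)) u :=
    hasStrictDerivAt_of_hasDerivAt_of_continuousAt (f' := fun t => -gg a b (C t))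
      (Eventually.of_forall A.dS)
      ((gg_continuous a b).comp A.cC).neg.continuousAt
  set P : ℝ × ℝ → ℝ × ℝ := fun z => (r * z.1 * C z.2, r * z.1 * S z.2) with hP
  have h1 : HasStrictFDerivAt (fun z : ℝ × ℝ => r * z.1)
      (r • ContinuousLinearMap.fst ℝ ℝ ℝ) ((1, u) : ℝ × ℝ) :=
    (hasStrictFDerivAt_fst (𝕜 := ℝ) (E := ℝ) (F := ℝ) (p := (1, u))).const_mul r
  have h2 : HasStrictFDerivAt (fun z : ℝ × ℝ => C z.2)
      (S u • ContinuousLinearMap.snd ℝ ℝ ℝ) ((1, u) : ℝ × ℝ) :=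
    HasStrictDerivAt.comp_hasStrictFDerivAt (f := fun z : ℝ × ℝ => z.2) (1, u) sC
      (hasStrictFDerivAt_snd (𝕜 := ℝ) (E := ℝ) (F := ℝ) (p := (1, u)))
  have h3 : HasStrictFDerivAt (fun z : ℝ × ℝ => S z.2)
      ((-gg a b (C u)) • ContinuousLinearMap.snd ℝ ℝ ℝ) ((1, u) : ℝ × ℝ) :=
    HasStrictDerivAt.comp_hasStrictFDerivAt (f := fun z : ℝ × ℝ => z.2) (1, u) sS
      (hasStrictFDerivAt_snd (𝕜 := ℝ) (E := ℝ) (F := ℝ) (p := (1, u)))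
  have h4 := (h1.mul h2).prodMk (h1.mul h3)
  have hsurj := h4.map_nhds_eq_of_surj (by
    rw [LinearMap.range_eq_top]
    rintro ⟨X, V⟩
    have e := A.en u
    rw [HH_eq] at e
    refine ⟨((gg a b (C u) * X + S u * V) / (a * r), (S u * X - C u * V) / (a * r)), ?_⟩
    have hne : a * r ≠ 0 := by positivity
    simp only [ContinuousLinearMap.coe_coe, ContinuousLinearMap.prod_apply, Prod.mk.injEq,
      ContinuousLinearMap.add_apply, ContinuousLinearMap.smul_apply, ContinuousLinearMap.coe_fst',
      ContinuousLinearMap.coe_snd', smul_eq_mul]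
    constructor
    · field_simp
      linear_combination X * e
    · field_simp
      linear_combination V * e)
  have hmem : Metric.closedBall ((1, u) : ℝ × ℝ) ζ ∈ nhds ((1, u) : ℝ × ℝ) :=
    Metric.closedBall_mem_nhds _ hζ
  have him := image_mem_map (m := P) hmem
  change P '' _ ∈ map P _ at him
  rw [show map P (nhds (1, u)) = nhds (P (1, u)) from hsurj] at him
  obtain ⟨ε, hε, hsub⟩ := Metric.mem_nhds_iff.1 him
  refine ⟨ε, hε, fun X V hX hV => ?_⟩
  have : ((X, V) : ℝ × ℝ) ∈ Metric.ball (P (1, u)) ε := by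
    rw [Metric.mem_ball, Prod.dist_eq, Real.dist_eq, Real.dist_eq]
    simp only [hP, mul_one]
    exact max_lt hX hV
  obtain ⟨⟨s, τ⟩, hz, hzz⟩ := hsub this
  rw [Metric.mem_closedBall, Prod.dist_eq, Real.dist_eq, Real.dist_eq] at hz
  simp only [hP, Prod.mk.injEq] at hzz
  refine ⟨s, τ - u, (le_max_left _ _).trans hz, (le_max_right _ _).trans hz, ?_, ?_⟩
  · rw [add_sub_cancel, hzz.1]
  · rw [add_sub_cancel, hzz.2]

/-- an open cone of points near a ray -/
def Cone (ε R X1 X2 V1 V2 : ℝ) : Set (ℝ × ℝ × ℝ × ℝ) :=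
  ⋃ l ∈ Set.Ioi R, Set.Ioo (l * X1 - ε * l) (l * X1 + ε * l) ×ˢ
    (Set.Ioo (l * X2 - ε * l) (l * X2 + ε * l) ×ˢ
    (Set.Ioo (l * V1 - ε * l) (l * V1 + ε * l) ×ˢ Set.Ioo (l * V2 - ε * l) (l * V2 + ε * l)))

lemma Cone_meas (ε R X1 X2 V1 V2 : ℝ) : MeasurableSet (Cone ε R X1 X2 V1 V2) := by
  apply IsOpen.measurableSet
  refine isOpen_biUnion fun l _ => ?_
  exact isOpen_Ioo.prod (isOpen_Ioo.prod (isOpen_Ioo.prod isOpen_Ioo))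

lemma Cone_vol {ε R : ℝ} (hε : 0 < ε) (hR : 0 < R) (X1 X2 V1 V2 : ℝ) :
    volume (Cone ε R X1 X2 V1 V2) = ⊤ := by
  have key : ∀ l > R, ENNReal.ofReal ((2 * ε * l) ^ 4) ≤ volume (Cone ε R X1 X2 V1 V2) := by
    intro l hl
    have hsub : Set.Ioo (l * X1 - ε * l) (l * X1 + ε * l) ×ˢ
      (Set.Ioo (l * X2 - ε * l) (l * X2 + ε * l) ×ˢ
      (Set.Ioo (l * V1 - ε * l) (l * V1 + ε * l) ×ˢ Set.Ioo (l * V2 - ε * l) (l * V2 + ε * l))) ⊆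
      Cone ε R X1 X2 V1 V2 := by
      intro z hz
      exact Set.mem_biUnion (Set.mem_Ioi.2 hl) hz
    refine le_trans (le_of_eq ?_) (measure_mono hsub)
    have e : ∀ X : ℝ, l * X + ε * l - (l * X - ε * l) = 2 * ε * l := fun X => by ring
    have hp : 0 ≤ 2 * ε * l := by have := hR.trans hl; positivity
    rw [Measure.volume_eq_prod, Measure.prod_prod, Measure.volume_eq_prod, Measure.prod_prod,
      Measure.volume_eq_prod, Measure.prod_prod]
    simp only [Real.volume_Ioo, e]
    rw [← ENNReal.ofReal_mul hp, ← ENNReal.ofReal_mul hp, ← ENNReal.ofReal_mul hp]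
    congr 1; ring
  by_contra hcon
  set v := (volume (Cone ε R X1 X2 V1 V2)).toReal with hv
  have hv0 : 0 ≤ v := ENNReal.toReal_nonneg
  have hl : R < R + (v + 1) / (2 * ε) := by
    have : 0 < (v + 1) / (2 * ε) := by positivity
    linarith
  have h1 := key _ hl
  rw [ENNReal.ofReal_le_iff_le_toReal hcon, ← hv] at h1
  have e : 2 * ε * (R + (v + 1) / (2 * ε)) = 2 * ε * R + (v + 1) := by field_simp
  rw [e] at h1
  have h2 : v + 1 ≤ 2 * ε * R + (v + 1) := by
    have : 0 < 2 * ε * R := by positivity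
    linarith
  have h3 : (v + 1) ^ 4 ≤ (2 * ε * R + (v + 1)) ^ 4 := pow_le_pow_left₀ (by linarith) h2 4
  have h4 : v + 1 ≤ (v + 1) ^ 4 := le_self_pow₀ (by linarith) (by norm_num)
  linarith

lemma main {n : ℕ} {a₁ b₁ h₁ : ℝ} {C₁ S₁ : ℝ → ℝ} {a₂ b₂ h₂ : ℝ} {C₂ S₂ : ℝ → ℝ} {p₁ φ₁ p₂ φ₂ : ℝ → ℝ}
    {c₁ c₂ u₁ u₂ j₁ j₂ m12 m21 : ℝ} (K₁ : Comp n a₁ b₁ h₁ C₁ S₁ a₂ b₂ h₂ C₂ S₂ p₁ φ₁ c₁ u₁ u₂ j₁ m12)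
    (K₂ : Comp n a₂ b₂ h₂ C₂ S₂ a₁ b₁ h₁ C₁ S₁ p₂ φ₂ c₂ u₂ u₁ j₂ m21) (hm : |m12 + m21| < 2) :
    ∃ E : Set (ℝ × ℝ × ℝ × ℝ), MeasurableSet E ∧ volume E = ⊤ ∧
      ∀ x₁ x₂ v₁ v₂ : ℝ → ℝ, Sol a₁ b₁ p₁ φ₁ x₁ v₁ x₂ → Sol a₂ b₂ p₂ φ₂ x₂ v₂ x₁ →
        (x₁ 0, x₂ 0, v₁ 0, v₂ 0) ∈ E →
        Tendsto (fun t => x₁ t ^ 2 + v₁ t ^ 2) atBot atTop ∧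
        Tendsto (fun t => x₂ t ^ 2 + v₂ t ^ 2) atBot atTop := by
  obtain ⟨ε, hε, δ, hδ, R, hR, H⟩ := escape K₁ K₂ hm
  have ha₁ := K₁.A.ha
  have ha₂ := K₂.A.ha
  have hj₁ := K₁.hj
  have hj₂ := K₂.hj
  set ζ := min (1 / 2) (min (ε / (2 + ε)) (δ / 2)) with hζdef
  have hζ : 0 < ζ := by positivity
  have z1 : ζ ≤ 1 / 2 := min_le_left _ _
  have z2 : ζ ≤ ε / (2 + ε) := (min_le_right _ _).trans (min_le_left _ _)
  have z3 : ζ ≤ δ / 2 := (min_le_right _ _).trans (min_le_right _ _)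
  rw [le_div_iff₀ (by positivity)] at z2
  obtain ⟨e1, he1, O1⟩ := polar_open K₁.A u₁ (r := j₁ / a₁) (by positivity) hζ
  obtain ⟨e2, he2, O2⟩ := polar_open K₂.A u₂ (r := j₂ / a₂) (by positivity) hζ
  have hem : 0 < min e1 e2 := lt_min he1 he2
  refine ⟨Cone (min e1 e2) (2 * R) (j₁ / a₁ * C₁ u₁) (j₂ / a₂ * C₂ u₂) (j₁ / a₁ * S₁ u₁)
    (j₂ / a₂ * S₂ u₂), Cone_meas _ _ _ _ _ _, Cone_vol hem (by positivity) _ _ _ _, ?_⟩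
  intro x₁ x₂ v₁ v₂ so1 so2 hE
  simp only [Cone, Set.mem_iUnion, Set.mem_prod, Set.mem_Ioo, Set.mem_Ioi, exists_prop] at hE
  obtain ⟨l, hl, m1, m2, m3, m4⟩ := hE
  have hl0 : 0 < l := by linarith
  have conv : ∀ x X e : ℝ, min e1 e2 ≤ e → l * X - min e1 e2 * l < x ∧ x < l * X + min e1 e2 * l →
      |x / l - X| < e := by
    intro x X e he hx
    have : x / l - X = (x - l * X) / l := by field_simp
    rw [this, abs_div, abs_of_pos hl0, div_lt_iff₀ hl0, abs_lt]
    have := mul_le_mul_of_nonneg_right he hl0.le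
    constructor <;> linarith [hx.1, hx.2]
  obtain ⟨s1, y1, hs1, hy1, X1, V1⟩ := O1 (x₁ 0 / l) (v₁ 0 / l) (conv _ _ _ (min_le_left _ _) m1)
    (conv _ _ _ (min_le_left _ _) m3)
  obtain ⟨s2, y2, hs2, hy2, X2, V2⟩ := O2 (x₂ 0 / l) (v₂ 0 / l) (conv _ _ _ (min_le_right _ _) m2)
    (conv _ _ _ (min_le_right _ _) m4)
  rw [div_eq_iff hl0.ne'] at X1 V1 X2 V2
  rw [abs_le] at hs1 hs2
  have k1 : l / 2 ≤ l * s1 := by linarith [mul_le_mul_of_nonneg_left (by linarith [hs1.1] : 1 / 2 ≤ s1) hl0.le]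
  have k2 : l / 2 ≤ l * s2 := by linarith [mul_le_mul_of_nonneg_left (by linarith [hs2.1] : 1 / 2 ≤ s2) hl0.le]
  have q : ∀ s s' : ℝ, s ≤ 1 + ζ → 1 - ζ ≤ s' → l * s ≤ (1 + ε) * (l * s') := by
    intro s s' h h'
    have : s ≤ (1 + ε) * s' := by
      have := mul_le_mul_of_nonneg_left h' (by linarith : 0 ≤ 1 + ε)
      linarith
    linarith [mul_le_mul_of_nonneg_left this hl0.le]
  have sq : ∀ y : ℝ, |y| ≤ ζ → y ^ 2 ≤ δ ^ 2 / 4 := by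
    intro y hy
    have := sq_le_sq' (abs_le.1 (hy.trans z3)).1 (abs_le.1 (hy.trans z3)).2
    linarith
  refine H x₁ x₂ v₁ v₂ so1 so2 (l * s1) (l * s2) y1 y2 ⟨by linarith, by linarith,
    q _ _ (by linarith [hs1.2]) (by linarith [hs2.1]), q _ _ (by linarith [hs2.2]) (by linarith [hs1.1]),
    ?_⟩ ?_ ?_ ?_ ?_
  · have := sq y1 hy1; have := sq y2 hy2
    have := sq_nonneg δ; linarith
  · rw [X1]; ring
  · rw [V1]; ring
  · rw [X2]; ring
  · rw [V2]; ring


lemma comp_of {n : ℕ} {a b h a' b' h' : ℝ} {C S C' S' : ℝ → ℝ} (A : ACos n a b h C S)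
    (A' : ACos n a' b' h' C' S') {γ α : ℝ} (hγ : γ = √(2 * n / a)) (hα : α = 1 / √a - √a / b)
    {K Λ p φ Φ : ℝ → ℝ} (hK : ∀ t, K t = ∫ s in (0 : ℝ)..t, C s)
    (hΛ : ∀ t, Λ t = K (t / n + h') - K (t / n - h'))
    (hp : Continuous p) (pp : ∀ t, p (t + 2 * π) = p t) (cφ : Continuous φ)
    (bφ : ∃ M, ∀ x, |φ x| ≤ M) {c : ℝ} (htop : Tendsto φ atTop (nhds c))
    (hbot : Tendsto φ atBot (nhds (-c)))
    (hΦ : ∀ θ, Φ θ = -(γ / 2) * ∫ t in (0 : ℝ)..(2 * π), C (θ / n + t) * p t)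
    {L : ℝ × ℝ → ℝ} (hL : ∀ θ : ℝ × ℝ, L θ = Φ θ.1 + γ * n * c * (Λ (θ.1 - θ.2) - α))
    (ω : ℝ × ℝ) (hω : L ω = 0) :
    ∃ D : ℝ × ℝ →L[ℝ] ℝ, HasFDerivAt L D ω ∧ (0 < D (1, 0) → ∃ j m κ : ℝ, 0 < κ ∧
      D (1, 0) = κ * j ∧ D (0, 1) = κ * j * m ∧
      Comp n a b h C S a' b' h' C' S' p φ c (ω.1 / n) (ω.2 / n) j m) := by
  have hn := A.hn
  have ha := A.ha
  have hγ0 : 0 < γ := by rw [hγ]; exact Real.sqrt_pos.2 (by positivity)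
  obtain ⟨-, hder, hform⟩ := QQ_facts A A' hp c
  have hLQ : ∀ θ : ℝ × ℝ, L θ = -(γ / 2) * QQ p c C' C (θ.1 / n) (θ.2 / n) := by
    intro θ
    rw [hL, hΦ, hΛ, hK, hK, hform, ← hα]
    have e1 : ∫ t in (0 : ℝ)..(2 * π), C (θ.1 / n + t) * p t =
        ∫ t in (-(2 * π))..0, p t * C (θ.1 / n + t) := by
      have per : Function.Periodic (fun t => p t * C (θ.1 / n + t)) (2 * π) := by
        intro t
        simp only
        rw [pp, ← add_assoc, A.per2 A.pC]
      have := per.intervalIntegral_add_eq 0 (-(2 * π))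
      rw [zero_add, neg_add_cancel] at this
      rw [← this]
      refine intervalIntegral.integral_congr fun t _ => ?_
      ring
    have e2 : (∫ s in (0:ℝ)..((θ.1 - θ.2) / n + h'), C s) - (∫ s in (0:ℝ)..((θ.1 - θ.2) / n - h'), C s) =
        ∫ t in (θ.1 / n - θ.2 / n - h')..(θ.1 / n - θ.2 / n + h'), C t := by
      rw [intervalIntegral.integral_interval_sub_left, sub_div] <;>
        exact A.cC.intervalIntegrable _ _
    rw [e1, e2]; ring
  obtain ⟨m', hm'⟩ := hder (ω.1 / n) (ω.2 / n)
  have hsc : HasFDerivAt (fun θ : ℝ × ℝ => (θ.1 / (n:ℝ), θ.2 / (n:ℝ)))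
      (((n:ℝ)⁻¹) • ContinuousLinearMap.id ℝ (ℝ × ℝ)) ω := by
    refine ((hasFDerivAt_id ω).const_smul ((n:ℝ)⁻¹)).congr_of_eventuallyEq
      (Eventually.of_forall fun θ => ?_)
    ext <;> simp [div_eq_inv_mul]
  have hcomp := (HasFDerivAt.comp (g := fun z : ℝ × ℝ => QQ p c C' C z.1 z.2)
    (f := fun θ : ℝ × ℝ => (θ.1 / (n:ℝ), θ.2 / (n:ℝ))) ω hm' hsc).const_mul (-(γ / 2))
  refine ⟨_, hcomp.congr_of_eventuallyEq (Eventually.of_forall hLQ), ?_⟩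
  intro hpos
  simp at hpos ⊢
  set Q := QQ p c C' S (ω.1 / n) (ω.2 / n) with hQ
  have hQ0 : Q < 0 := by
    by_contra hc
    push Not at hc
    have : 0 ≤ γ / 2 * (Q * (n:ℝ)⁻¹) := by positivity
    nlinarith
  refine ⟨-Q, -m' / (-Q), γ / 2 * (n:ℝ)⁻¹, by positivity, by ring, ?_, ?_⟩
  · have hQne : Q ≠ 0 := hQ0.ne
    field_simp
  · refine ⟨A, A', hp, pp, cφ, bφ, htop, hbot, by linarith, by rw [neg_neg], ?_, ?_⟩
    · have := hLQ ω
      rw [hω] at this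
      rcases mul_eq_zero.1 this.symm with h | h
      · linarith
      · exact h
    · have : - -Q * (-m' / -Q) = m' := by
        have : Q ≠ 0 := hQ0.ne
        field_simp
      rw [this]; exact hm'

theorem stmt12 (n : ℕ) (hn : 1 ≤ n)
    (a₁ b₁ a₂ b₂ : ℝ)
    (ha₁ : (n : ℝ) ^ 2 / 4 < a₁) (hb₁ : 0 < b₁)
    (ha₂ : (n : ℝ) ^ 2 / 4 < a₂) (hb₂ : 0 < b₂)
    (hres₁ : 1 / Real.sqrt a₁ + 1 / Real.sqrt b₁ = 2 / (n : ℝ))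
    (hres₂ : 1 / Real.sqrt a₂ + 1 / Real.sqrt b₂ = 2 / (n : ℝ))
    (C₁ C₂ : ℝ → ℝ) (hC₁ : IsAsymCos n a₁ b₁ C₁) (hC₂ : IsAsymCos n a₂ b₂ C₂)
    (γ₁ γ₂ α₁ α₂ : ℝ)
    (hγ₁ : γ₁ = Real.sqrt (2 * n / a₁)) (hγ₂ : γ₂ = Real.sqrt (2 * n / a₂))
    (hα₁ : α₁ = 1 / Real.sqrt a₁ - Real.sqrt a₁ / b₁)
    (hα₂ : α₂ = 1 / Real.sqrt a₂ - Real.sqrt a₂ / b₂)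
    (K₁ K₂ : ℝ → ℝ)
    (hK₁ : ∀ t, K₁ t = ∫ s in (0 : ℝ)..t, C₁ s)
    (hK₂ : ∀ t, K₂ t = ∫ s in (0 : ℝ)..t, C₂ s)
    (Λ₁ Λ₂ : ℝ → ℝ)
    (hΛ₁ : ∀ t, Λ₁ t = K₁ (t / n + π / (2 * Real.sqrt a₂)) - K₁ (t / n - π / (2 * Real.sqrt a₂)))
    (hΛ₂ : ∀ t, Λ₂ t = K₂ (t / n + π / (2 * Real.sqrt a₁)) - K₂ (t / n - π / (2 * Real.sqrt a₁)))
    (p₁ p₂ : ℝ → ℝ) (hp₁ : Continuous p₁) (hp₂ : Continuous p₂)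
    (hp₁per : ∀ t, p₁ (t + 2 * π) = p₁ t) (hp₂per : ∀ t, p₂ (t + 2 * π) = p₂ t)
    (φ₁ φ₂ : ℝ → ℝ) (hφ₁lip : LocallyLipschitz φ₁) (hφ₂lip : LocallyLipschitz φ₂)
    (hφ₁bdd : ∃ M, ∀ x, |φ₁ x| ≤ M) (hφ₂bdd : ∃ M, ∀ x, |φ₂ x| ≤ M)
    (φ₁inf φ₂inf : ℝ)
    (hφ₁top : Tendsto φ₁ atTop (nhds φ₁inf)) (hφ₁bot : Tendsto φ₁ atBot (nhds (-φ₁inf)))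
    (hφ₂top : Tendsto φ₂ atTop (nhds φ₂inf)) (hφ₂bot : Tendsto φ₂ atBot (nhds (-φ₂inf)))
    (Φ₁ Φ₂ : ℝ → ℝ)
    (hΦ₁ : ∀ θ, Φ₁ θ = -(γ₁ / 2) * ∫ t in (0 : ℝ)..(2 * π), C₁ (θ / n + t) * p₁ t)
    (hΦ₂ : ∀ θ, Φ₂ θ = -(γ₂ / 2) * ∫ t in (0 : ℝ)..(2 * π), C₂ (θ / n + t) * p₂ t)
    (L₁ L₂ : ℝ × ℝ → ℝ)
    (hL₁ : ∀ θ : ℝ × ℝ, L₁ θ = Φ₁ θ.1 + γ₁ * n * φ₁inf * (Λ₁ (θ.1 - θ.2) - α₁))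
    (hL₂ : ∀ θ : ℝ × ℝ, L₂ θ = Φ₂ θ.2 + γ₂ * n * φ₂inf * (Λ₂ (θ.2 - θ.1) - α₂))
    (ω : ℝ × ℝ) (hω₁ : L₁ ω = 0) (hω₂ : L₂ ω = 0)
    (hD11 : fderiv ℝ L₁ ω (1, 0) > 0) (hD22 : fderiv ℝ L₂ ω (0, 1) > 0)
    (hDmix : |fderiv ℝ L₁ ω (0, 1) * fderiv ℝ L₂ ω (0, 1) +
        fderiv ℝ L₁ ω (1, 0) * fderiv ℝ L₂ ω (1, 0)| <
      2 * (fderiv ℝ L₁ ω (1, 0) * fderiv ℝ L₂ ω (0, 1))) :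
    ∃ E : Set (ℝ × ℝ × ℝ × ℝ), MeasurableSet E ∧ volume E = ⊤ ∧
      ∀ x₁ x₂ v₁ v₂ : ℝ → ℝ,
        (∀ t ∈ Set.Iic (0 : ℝ),
          HasDerivAt x₁ (v₁ t) t ∧ HasDerivAt x₂ (v₂ t) t ∧
          HasDerivAt v₁ (p₁ t - a₁ * max (x₁ t) 0 + b₁ * max (-x₁ t) 0 - φ₁ (x₂ t)) t ∧
          HasDerivAt v₂ (p₂ t - a₂ * max (x₂ t) 0 + b₂ * max (-x₂ t) 0 - φ₂ (x₁ t)) t) →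
        (x₁ 0, x₂ 0, v₁ 0, v₂ 0) ∈ E →
        (Tendsto (fun t => (x₁ t) ^ 2 + (v₁ t) ^ 2) atBot atTop ∧
         Tendsto (fun t => (x₂ t) ^ 2 + (v₂ t) ^ 2) atBot atTop) := by
  obtain ⟨S₁, A₁⟩ := asymcos_props hn ha₁ hb₁ hres₁ hC₁
  obtain ⟨S₂, A₂⟩ := asymcos_props hn ha₂ hb₂ hres₂ hC₂
  obtain ⟨D₁, hD₁, R₁⟩ := comp_of A₁ A₂ hγ₁ hα₁ hK₁ hΛ₁ hp₁ hp₁per hφ₁lip.continuous hφ₁bdd hφ₁top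
    hφ₁bot hΦ₁ hL₁ ω hω₁
  obtain ⟨D₂, hD₂, R₂⟩ := comp_of A₂ A₁ hγ₂ hα₂ hK₂ hΛ₂ hp₂ hp₂per hφ₂lip.continuous hφ₂bdd hφ₂top
    hφ₂bot hΦ₂ (L := fun θ => L₂ (θ.2, θ.1)) (fun θ => hL₂ (θ.2, θ.1)) (ω.2, ω.1) hω₂
  have hsw : HasFDerivAt (fun θ : ℝ × ℝ => (θ.2, θ.1))
      ((ContinuousLinearMap.snd ℝ ℝ ℝ).prod (ContinuousLinearMap.fst ℝ ℝ ℝ)) ω :=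
    ((ContinuousLinearMap.snd ℝ ℝ ℝ).prod (ContinuousLinearMap.fst ℝ ℝ ℝ)).hasFDerivAt
  have hD₂' : HasFDerivAt L₂ _ ω :=
    HasFDerivAt.comp (g := fun θ : ℝ × ℝ => L₂ (θ.2, θ.1)) (f := fun θ : ℝ × ℝ => (θ.2, θ.1)) ω hD₂ hsw
  rw [hD₁.fderiv] at hD11 hDmix
  rw [hD₂'.fderiv] at hD22 hDmix
  simp only [ContinuousLinearMap.comp_apply, ContinuousLinearMap.prod_apply,
    ContinuousLinearMap.coe_fst', ContinuousLinearMap.coe_snd'] at hD22 hDmix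
  obtain ⟨j₁, m₁, κ₁, hκ₁, d11, d12, Co₁⟩ := R₁ hD11
  obtain ⟨j₂, m₂, κ₂, hκ₂, d22, d21, Co₂⟩ := R₂ hD22
  have hm : |m₁ + m₂| < 2 := by
    rw [d11, d12, d22, d21] at hDmix
    have hj₁ := Co₁.hj
    have hj₂ := Co₂.hj
    have hpos : 0 < κ₁ * j₁ * (κ₂ * j₂) := by positivity
    have e : κ₁ * j₁ * m₁ * (κ₂ * j₂) + κ₁ * j₁ * (κ₂ * j₂ * m₂) =
      κ₁ * j₁ * (κ₂ * j₂) * (m₁ + m₂) := by ring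
    rw [e, abs_mul, abs_of_pos hpos, mul_comm 2] at hDmix
    exact lt_of_mul_lt_mul_left hDmix hpos.le
  obtain ⟨E, hE1, hE2, hE3⟩ := main Co₁ Co₂ hm
  refine ⟨E, hE1, hE2, fun x₁ x₂ v₁ v₂ hsol hin => hE3 x₁ x₂ v₁ v₂ ?_ ?_ hin⟩
  · intro t ht
    obtain ⟨s1, s2, s3, s4⟩ := hsol t ht
    refine ⟨s1, ?_⟩
    have e : p₁ t - φ₁ (x₂ t) - gg a₁ b₁ (x₁ t) =
      p₁ t - a₁ * max (x₁ t) 0 + b₁ * max (-x₁ t) 0 - φ₁ (x₂ t) := by unfold gg; ring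
    rw [e]; exact s3
  · intro t ht
    obtain ⟨s1, s2, s3, s4⟩ := hsol t ht
    refine ⟨s2, ?_⟩
    have e : p₂ t - φ₂ (x₁ t) - gg a₂ b₂ (x₂ t) =
      p₂ t - a₂ * max (x₂ t) 0 + b₂ * max (-x₂ t) 0 - φ₂ (x₁ t) := by unfold gg; ring
    rw [e]; exact s4
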